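/- arXiv:cs/0305016 — 3 statements merged into one kernel-verified Lean document; each statement's English description precedes it below -/
import Mathlib

section
/- Let ρ be a real number with 0 < ρ ≤ √3/2, and set W = {(1/4, ρ/2), (3/4, ρ/2)} ⊆ Q. Then for every set B ⊆ Q with |B| = 2 one has μ({q ∈ Q : infDist(q, B) < infDist(q, W)}) < ρ/2. (Wilma wins the two-point game for aspect ratio at most √3/2 by playing the 1×2 grid.) -/
open MeasureTheory Metric Set
open scoped ENNReal

/-- The point `(x, y)` in the Euclidean plane. -/
noncomputable def pt (x y : ℝ) : EuclideanSpace ℝ (Fin 2) :=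
  (WithLp.equiv 2 (Fin 2 → ℝ)).symm ![x, y]

/-- The rectangular board `[0,1] × [0,ρ]`. -/
def board (ρ : ℝ) : Set (EuclideanSpace ℝ (Fin 2)) :=
  {q | q 0 ∈ Set.Icc (0:ℝ) 1 ∧ q 1 ∈ Set.Icc (0:ℝ) ρ}

lemma poly2a (s d v : ℝ) (hs : 0 < s) (hs3 : s^2 = 3) (hd : 0 ≤ d) (hd1 : d ≤ 1) (hv : 0 < v) (hvs : v ≤ s) :
    (d^2+v^2)^2/4 + (d^2+v^2)*d < (s*d-v)^2 + s*(d^2+v^2)*v := by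
  have h1 : s < 1.7321 := by nlinarith
  have h2 : 1.732 < s := by nlinarith
  by_cases h : d ≤ v
  · have : (d^2+v^2)/4 + d < s * v := by nlinarith
    nlinarith [sq_nonneg (s*d-v), mul_pos hv hv, sq_nonneg d]
  · push Not at h
    have hr : (d^2+v^2) ≤ 2*d := by nlinarith
    have hr0 : 0 < d^2+v^2 := by positivity
    have h3 : (d^2+v^2)^2/4 ≤ (d^2+v^2) * (d/2) := by nlinarith
    have h4 : (d^2+v^2)*(1.5*d-s*v) < d * (s*d-v)^2 := by
      have e : d * (s*d-v)^2 - (d^2+v^2)*(1.5*d-s*v) = 1.5*d^3 - s*d^2*v - 0.5*d*v^2+s*v^3 := by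
        linear_combination d^3 * hs3
      have hd0 : 0 < d := hv.trans h
      have : 0 < 1.5*d^3 - 1.7321*d^2*v - 0.5*d*v^2+1.732*v^3 := by
        nlinarith [mul_nonneg hd0.le (sq_nonneg (d-1.5*v)), mul_nonneg hv.le (sq_nonneg (d-1.5*v)), pow_pos hv 3, pow_pos hd0 3]
      nlinarith [mul_pos (mul_pos hd0 hd0) hv, pow_pos hv 3]
    nlinarith [sq_nonneg (s*d-v)]

lemma poly2b_key (M e d k v y : ℝ) (hd : 0 < d) (hd1 : d ≤ 1) (he : e = d * (2-d))
   (hk : k = (e - v^2)/2) (hM : 0 < M) (he0 : 0 < e) (h5 : M * (1-d) < k)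
   (hyy : y^2 = 2*M*e) (hye : e < y) : 12*e*(y-e)^2 < (y^2)^2 := by
  have hye' : 0 < y - e := sub_pos.2 hye
  by_cases h4 : 3/4 < e
  · have a1 : 4*e*(y-e) ≤ y^2 := by linarith [sq_nonneg (y-2*e)]
    have a2 : (4*e*(y-e))^2 ≤ (y^2)^2 := pow_le_pow_left₀ (by positivity) a1 2
    have a3 : 0 < e * (y-e)^2 := by positivity
    have a4 : 0 < (16*e-12) * (e * (y-e)^2) := mul_pos (by linarith) a3
    have a5 : (16*e-12) * (e * (y-e)^2) = (4*e*(y-e))^2 - 12*e*(y-e)^2 := by ring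
    linarith
  push Not at h4
  have hdd : d ≤ 1/2 := by rw [he] at h4; nlinarith
  have b1 : 2*M*(1-d) < e := by linarith [sq_nonneg v]
  have b2 : 2*M - e < 2*M*d := by linarith
  have h6 : 3 * d^2 ≤ e := by rw [he]; nlinarith
  have b0 : 0 < 2*M - e := by
    have : e * e < 2*M*e := by rw [← hyy]; nlinarith
    have := lt_of_mul_lt_mul_right this he0.le
    linarith
  have b3 : 3*(2*M-e)^2 < e*(2*M)^2 := by
    have t1 : (2*M-e)^2 < (2*M*d)^2 := pow_lt_pow_left₀ b2 b0.le (by norm_num)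
    have t2 : 3*d^2 * (2*M)^2 ≤ e * (2*M)^2 := by gcongr
    linarith
  have b4 : 2*(y-e) ≤ 2*M-e := by
    have : e*(2*(y-e)) ≤ e*(2*M-e) := by linarith [sq_nonneg (y-e)]
    exact le_of_mul_le_mul_left this he0
  have b5 : (2*(y-e))^2 ≤ (2*M-e)^2 := pow_le_pow_left₀ (by linarith) b4 2
  rw [hyy]
  have b6 : 3*(2*(y-e))^2 < e*(2*M)^2 := by linarith
  have := mul_lt_mul_of_pos_left b6 he0
  linarith

lemma poly2b (M e d k v: ℝ) (hd : 0 < d) (hd1 : d ≤ 1) (he : e = d * (2-d))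
   (hk : k = (e - v^2)/2) (hM : 0 < M) (hkM : k < M) (hMv : M^2 ≤ 3 * v^2) (h0 : 0 < k + M) (h : k + M < 2 * d) : (k+M)^2 < 2*M*e := by
  have he0 : 0 < e := by rw [he]; nlinarith
  have he1 : e ≤ 1 := by rw [he]; nlinarith [sq_nonneg (1-d)]
  by_cases h2 : 2 * M ≤ e
  · nlinarith
  push Not at h2
  by_cases h5 : k ≤ M * (1-d)
  · have : k + M ≤ M * (2-d) := by linarith
    rw [he]; nlinarith
  push Not at h5
  have hkk : k + M ≤ e/2 + M - M^2/6 := by rw [hk]; nlinarith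
  set y := Real.sqrt (2*M*e) with hy
  have hyy : y^2 = 2*M*e := Real.sq_sqrt (by positivity)
  have hy0 : 0 ≤ y := Real.sqrt_nonneg _
  have hye : e < y := by nlinarith
  have key : 12*e*(y-e)^2 < (y^2)^2 := poly2b_key M e d k v y hd hd1 he hk hM he0 h5 hyy hye
  have fin : e/2 + M - M^2/6 < y := by
    have : 24*e^2*(e/2 + M - M^2/6) < 24*e^2*y := by
      have : 24*e^2*M = 12 * e * y^2 := by rw [hyy]; ring
      have : 4*e^2*M^2 = (y^2)^2 := by rw [hyy]; ring
      nlinarith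
    exact lt_of_mul_lt_mul_left this (by positivity)
  rw [← hyy]
  exact pow_lt_pow_left₀ (by linarith) h0.le (by norm_num)


noncomputable def cl (N z : ℝ) : ℝ := max 0 (min z N)
noncomputable def JJ (N a m : ℝ) : ℝ := ∫ s in (0:ℝ)..(1/2), cl N (a - m * s)

lemma cl_cont (N : ℝ) : Continuous (cl N) := by unfold cl; fun_prop

lemma cl_ii (N a m x y : ℝ) : IntervalIntegrable (fun s => cl N (a - m*s)) MeasureTheory.volume x y := by
  apply Continuous.intervalIntegrable
  have := cl_cont N
  fun_prop

lemma P_deriv (z : ℝ) : HasDerivAt (fun z : ℝ => (max z 0)^2) (2 * max z 0) z := by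
  rcases lt_trichotomy z 0 with h | h | h
  · rw [max_eq_right h.le]
    have : HasDerivAt (fun _ : ℝ => (0:ℝ)) (2*0) z := by simpa using hasDerivAt_const z (0:ℝ)
    apply this.congr_of_eventuallyEq
    filter_upwards [gt_mem_nhds h] with x hx
    simp [max_eq_right hx.le]
  · subst h
    rw [hasDerivAt_iff_isLittleO]
    simp only [max_self, mul_zero, sub_zero, smul_zero]
    have : (fun x : ℝ => (max x 0)^2 - 0^2) =O[nhds 0] fun x => x^2 := by
      apply Asymptotics.IsBigO.of_bound 1
      filter_upwards with x
      rcases le_total x 0 with h | h <;> simp [h]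
      positivity
    apply this.trans_isLittleO
    exact Asymptotics.isLittleO_pow_id (by norm_num)
  · rw [max_eq_left h.le]
    have : HasDerivAt (fun x : ℝ => x^2) (2*z) z := by simpa using hasDerivAt_pow 2 z
    apply this.congr_of_eventuallyEq
    filter_upwards [lt_mem_nhds h] with x hx
    simp [max_eq_left hx.le]

lemma cl_eq (N z : ℝ) (hN : 0 ≤ N) : cl N z = max z 0 - max (z-N) 0 := by
  unfold cl
  rcases le_total z 0 with h | h <;> rcases le_total z N with h' | h' <;> 
   simp [h, h', hN] 
  all_goals try linarith
  
lemma JJ_eq (N a m : ℝ) (hN : 0 ≤ N) (hm : 0 < m) :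
    JJ N a m = (max a 0^2 - max (a - m/2) 0^2 - max (a-N) 0^2 + max (a-N-m/2) 0^2)/(2*m) := by
  unfold JJ
  have : ∀ s ∈ Set.uIcc (0:ℝ) (1/2), HasDerivAt (fun s => (- max (a - m*s) 0^2 + max (a - m*s - N) 0^2)/(2*m)) (cl N (a - m*s)) s := by
    intro s _
    rw [cl_eq _ _ hN]
    have h1 : HasDerivAt (fun s => a - m * s) (-m) s := by
      simpa using ((hasDerivAt_id s).const_mul m).const_sub a
    have h2 := (P_deriv (a-m*s)).comp s h1
    have h3 := (P_deriv (a-m*s-N)).comp s (h1.sub_const N)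
    have h4 := (h2.neg.add h3).div_const (2*m)
    have h5 : max (a - m*s) 0 - max (a - m*s - N) 0 = (-(2 * max (a - m * s) 0 * -m) + 2 * max (a - m * s - N) 0 * -m) / (2 * m) := by
      rw [eq_div_iff (by positivity)]
      ring
    rw [h5]
    exact h4
  rw [intervalIntegral.integral_eq_sub_of_hasDerivAt this (cl_ii _ _ _ _ _)]
  ring_nf

lemma L1 (N a m : ℝ) (hN : 0 ≤ N) (hm : 0 < m) (ha : 0 ≤ a) : JJ N a m ≤ a^2/(2*m) := by
  rw [JJ_eq N a m hN hm]
  gcongr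
  rw [max_eq_left ha]
  have : max (a-N-m/2) 0^2 ≤ max (a-N) 0^2 := by
    apply pow_le_pow_left₀ (le_max_right _ _)
    apply max_le_max _ le_rfl
    linarith
  nlinarith [sq_nonneg (max (a-m/2) 0)]

lemma L3 (N a m : ℝ) (hN : 0 ≤ N) (hm : 0 < m) (ha : N ≤ a) : JJ N a m ≤ N * (2*a-N)/(2*m) := by
  rw [JJ_eq N a m hN hm]
  gcongr
  rw [max_eq_left (by linarith), max_eq_left (by linarith : (0:ℝ) ≤ a - N)]
  have : max (a-N-m/2) 0^2 ≤ max (a-m/2) 0^2 := by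
    apply pow_le_pow_left₀ (le_max_right _ _)
    apply max_le_max _ le_rfl
    linarith
  nlinarith 

lemma L2 (N a m : ℝ) (hm : 0 ≤ m) (ha : m / 2 ≤ a) : JJ N a m ≤ a/2 - m/8 := by
  have : ∫ s in (0:ℝ)..(1/2), (a - m*s) = a/2 - m/8 := by
    rw [intervalIntegral.integral_sub (by simp) (Continuous.intervalIntegrable (by fun_prop) _ _)]
    rw [intervalIntegral.integral_const_mul, integral_id]
    simp
    ring
  rw [← this]
  unfold JJ
  apply intervalIntegral.integral_mono_on (by norm_num) (cl_ii _ _ _ _ _) (Continuous.intervalIntegrable (by fun_prop) _ _)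
  intro x hx
  unfold cl
  apply max_le _ (min_le_left _ _)
  nlinarith [hx.1, hx.2]

/-- main inequality for `0 ≤ U ≤ 1/4`, `0 < V`. -/
lemma mainJ0 (ρ U V : ℝ) (hρ : 0 < ρ) (hρ1 : ρ ≤ Real.sqrt 3 / 2) (hU : 0 ≤ U) (hU1 : U ≤ 1/4)
    (hV : 0 < V) (hV1 : V ≤ ρ/2) :
    JJ (V*ρ) (V*ρ/2 - (U^2+V^2-1/16)/2) (1/4-U) + JJ (V*ρ) (V*ρ/2 - (U^2+V^2-1/16)/2) (1/4+U) < V*ρ/4 := by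
  obtain ⟨d, rfl⟩ : ∃ d, U = (1-d)/4 := ⟨1-4*U, by ring⟩
  obtain ⟨v, rfl⟩ : ∃ v, V = v/4 := ⟨4*V, by ring⟩
  obtain ⟨H, rfl⟩ : ∃ H, ρ = H/2 := ⟨2*ρ, by ring⟩
  set s := Real.sqrt 3 with hs
  have hs3 : s^2 = 3 := Real.sq_sqrt (by norm_num)
  have hs0 : 0 < s := Real.sqrt_pos.2 (by norm_num)
  have hd : 0 ≤ d := by linarith
  have hd1 : d ≤ 1 := by linarith
  have hv : 0 < v := by linarith
  have hH : 0 < H := by linarith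
  have hHs : H ≤ s := by linarith
  have hvH : v ≤ H := by linarith
  obtain ⟨M, hM⟩ : ∃ M, M = H * v := ⟨_, rfl⟩
  obtain ⟨e, he⟩ : ∃ e, e = d * (2-d) := ⟨_, rfl⟩
  obtain ⟨k, hk⟩ : ∃ k, k = (e-v^2)/2 := ⟨_, rfl⟩
  have e1 : v/4*(H/2) = M/8 := by rw [hM]; ring
  have e2 : v/4*(H/2)/2 - (((1-d)/4)^2+(v/4)^2-1/16)/2 = (k+M)/16 := by
    rw [hk, he, hM]; ring
  rw [e2, e1, show 1/4-(1-d)/4 = d/4 by ring, show 1/4+(1-d)/4 = (2-d)/4 by ring]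
  have hM0 : 0 < M := by rw [hM]; positivity
  have hMv2 : v^2 ≤ M := by rw [hM]; nlinarith
  have he0 : 0 ≤ e := by rw [he]; nlinarith
  have hkM0 : 0 < k + M := by nlinarith
  have hMv : M^2 ≤ 3*v^2 := by
    rw [hM, mul_pow, ← hs3]
    gcongr
  have h2d : 0 < 2 - d := by linarith
  by_cases c1 : M ≤ k
  · have he0' : 0 < e := by nlinarith
    have hd0 : 0 < d := by
      rcases hd.eq_or_lt with h | h
      · rw [← h] at he; simp at he; linarith
      · exact h
    have l1 := L3 (M/8) ((k+M)/16) (d/4) (by positivity) (by positivity) (by linarith)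
    have l2 := L3 (M/8) ((k+M)/16) ((2-d)/4) (by positivity) (by positivity) (by linarith)
    have : M/8*(2*((k+M)/16)-M/8)/(2*(d/4)) + M/8*(2*((k+M)/16)-M/8)/(2*((2-d)/4)) = M * (2*k)/(32*e) := by
      rw [he]
      field_simp
      ring
    have h3 : M * (2*k)/(32*e) < M/32 := by
      rw [div_lt_div_iff₀ (by positivity) (by norm_num)]
      have : 2*k < e := by linarith [pow_pos hv 2]
      have := mul_lt_mul_of_pos_left this hM0
      linarith
    linarith
  push Not at c1
  have l2 := L1 (M/8) ((k+M)/16) ((2-d)/4) (by positivity) (by positivity) (by linarith)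
  by_cases c2 : 2*d ≤ k+M
  · have l1 := L2 (M/8) ((k+M)/16) (d/4) (by positivity) (by linarith)
    have p := poly2a s d v hs0 hs3 hd hd1 hv (by linarith)
    have p2 : (k+M)^2 < 2*(2-d)*(d^2+v^2) := by
      have : k + M ≤ d - (d^2+v^2)/2 + s*v := by rw [hk, he, hM]; nlinarith
      have : (k+M)^2 ≤ (d - (d^2+v^2)/2 + s*v)^2 := pow_le_pow_left₀ hkM0.le this 2
      have : (d - (d^2+v^2)/2 + s*v)^2 - 2*(2-d)*(d^2+v^2) = (d^2+v^2)^2/4 + (d^2+v^2)*d -( (s*d-v)^2 + s*(d^2+v^2)*v) := by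
        linear_combination (d^2+v^2)* hs3
      linarith
    have p3 : ((k+M)/16)^2/(2*((2-d)/4)) < (d^2+v^2)/64 := by
      rw [div_lt_iff₀ (by positivity)]
      linarith
    have : 2*k = 2*d - d^2 - v^2 := by rw [hk, he]; ring
    linarith
  · push Not at c2
    have hd0 : 0 < d := by linarith
    have l1 := L1 (M/8) ((k+M)/16) (d/4) (by positivity) (by positivity) (by linarith)
    have p := poly2b M e d k v hd0 hd1 he hk hM0 c1 hMv hkM0 c2
    have he0' : 0 < e := by rw [he]; positivity
    have : ((k+M)/16)^2/(2*(d/4)) + ((k+M)/16)^2/(2*((2-d)/4)) = (k+M)^2/(64*e) := by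
      rw [he]
      field_simp
      ring
    have : (k+M)^2/(64*e) < M/32 := by
      rw [div_lt_div_iff₀ (by positivity) (by norm_num)]
      linarith
    linarith

lemma JJ_reflect (N a m : ℝ) : JJ N a m = JJ N (a - m/2) (-m) := by
  unfold JJ
  have := intervalIntegral.integral_comp_sub_left (a := 0) (b := 1/2) (fun s => cl N (a - m*s)) (1/2)
  simp only [sub_self, sub_zero] at this
  rw [← this]
  congr 1
  ext s
  congr 1
  ring

lemma cl_mono (N : ℝ) {x y : ℝ} (h : x ≤ y) : cl N x ≤ cl N y :=
  max_le_max le_rfl (min_le_min h le_rfl)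

lemma mainJ1 (ρ U V : ℝ) (hρ : 0 < ρ) (hρ1 : ρ ≤ Real.sqrt 3 / 2) (hU : 0 ≤ U) (hU1 : U ≤ 1/2)
    (hV : 0 < V) (hV1 : V ≤ ρ/2) :
    JJ (V*ρ) (V*ρ/2 - (U^2+V^2-1/16)/2) (1/4-U) + JJ (V*ρ) (V*ρ/2 - (U^2+V^2-1/16)/2) (1/4+U) < V*ρ/4 := by
  rcases le_total U (1/4) with h | h
  · exact mainJ0 ρ U V hρ hρ1 hU h hV hV1
  · refine lt_of_le_of_lt ?_ (mainJ0 ρ (1/2-U) V hρ hρ1 (by linarith) (by linarith) hV hV1)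
    apply add_le_add
    · rw [JJ_reflect]
      apply le_of_eq
      congr 1 <;> ring
    · unfold JJ
      apply intervalIntegral.integral_mono_on (by norm_num) (cl_ii _ _ _ _ _) (cl_ii _ _ _ _ _)
      intro x hx
      apply cl_mono
      nlinarith [hx.1, hx.2]

lemma mainJ (ρ U V : ℝ) (hρ : 0 < ρ) (hρ1 : ρ ≤ Real.sqrt 3 / 2) (hU : -(1/2) ≤ U) (hU1 : U ≤ 1/2)
    (hV : 0 < V) (hV1 : V ≤ ρ/2) :
    JJ (V*ρ) (V*ρ/2 - (U^2+V^2-1/16)/2) (1/4-U) + JJ (V*ρ) (V*ρ/2 - (U^2+V^2-1/16)/2) (1/4+U) < V*ρ/4 := by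
  rcases le_total 0 U with h | h
  · exact mainJ1 ρ U V hρ hρ1 h hU1 hV hV1
  · have := mainJ1 ρ (-U) V hρ hρ1 (by linarith) (by linarith) hV hV1
    rw [neg_sq, sub_neg_eq_add, ← sub_eq_add_neg] at this
    linarith

lemma sliceBound (ρ V D : ℝ) (hV : V ≠ 0) :
    volume {y : ℝ | y ∈ Icc 0 ρ ∧ D < V*(y-ρ/2)} ≤ ENNReal.ofReal (cl (|V| * ρ) (|V| * ρ/2 - D)/|V|) := by
  rcases hV.lt_or_gt with h | h
  · have hsub : {y : ℝ | y ∈ Icc 0 ρ ∧ D < V*(y-ρ/2)} ⊆ Icc 0 (min ρ (ρ/2+D/V)) := by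
      rintro y ⟨⟨h0, h1⟩, h2⟩
      refine ⟨h0, le_min h1 ?_⟩
      have : y - ρ/2 < D/V := by rw [lt_div_iff_of_neg h]; linarith
      linarith
    refine (measure_mono hsub).trans ?_
    rw [Real.volume_Icc]
    apply ENNReal.ofReal_le_ofReal
    rw [abs_of_neg h, le_div_iff₀ (by linarith)]
    unfold cl
    apply le_max_of_le_right
    apply le_min
    · have : min ρ (ρ/2+D/V) * -V ≤ (ρ/2+D/V) * -V :=
        mul_le_mul_of_nonneg_right (min_le_right _ _) (by linarith)
      have e : (ρ/2+D/V) * -V = -V*ρ/2 - D := by field_simp; ring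
      rw [sub_zero]; linarith
    · have : min ρ (ρ/2+D/V) * -V ≤ ρ * -V :=
        mul_le_mul_of_nonneg_right (min_le_left _ _) (by linarith)
      rw [sub_zero]; linarith
  · have hsub : {y : ℝ | y ∈ Icc 0 ρ ∧ D < V*(y-ρ/2)} ⊆ Icc (max 0 (ρ/2+D/V)) ρ := by
      rintro y ⟨⟨h0, h1⟩, h2⟩
      refine ⟨max_le h0 ?_, h1⟩
      have : D/V < y - ρ/2 := by rw [div_lt_iff₀ h]; linarith
      linarith
    refine (measure_mono hsub).trans ?_
    rw [Real.volume_Icc]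
    apply ENNReal.ofReal_le_ofReal
    rw [abs_of_pos h, le_div_iff₀ h]
    unfold cl
    apply le_max_of_le_right
    apply le_min
    · have : (ρ/2+D/V) * V ≤ max 0 (ρ/2+D/V) * V :=
        mul_le_mul_of_nonneg_right (le_max_right _ _) h.le
      have e : (ρ/2+D/V) * V = V*ρ/2 + D := by field_simp
      linarith
    · have : 0 * V ≤ max 0 (ρ/2+D/V) * V :=
        mul_le_mul_of_nonneg_right (le_max_left _ _) h.le
      linarith

def Cset (ρ U V : ℝ) : Set (ℝ × ℝ) :=
  {p | p.1 ∈ Icc (0:ℝ) 1 ∧ p.2 ∈ Icc (0:ℝ) ρ ∧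
    (U^2+V^2-1/16)/2 + |p.1-1/2|/4 - U*(p.1-1/2) < V*(p.2-ρ/2)}

lemma Cset_meas (ρ U V : ℝ) : MeasurableSet (Cset ρ U V) := by
  unfold Cset
  have h3 : MeasurableSet {p : ℝ × ℝ | (U^2+V^2-1/16)/2 + |p.1-1/2|/4 - U*(p.1-1/2) < V*(p.2-ρ/2)} := by
    refine measurableSet_lt ?_ ?_
    · apply Continuous.measurable; fun_prop
    · apply Continuous.measurable; fun_prop
  exact (measurableSet_Icc.preimage measurable_fst).inter
    ((measurableSet_Icc.preimage measurable_snd).inter h3)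

lemma Cset_vol_pos (ρ U V : ℝ) (hρ : 0 < ρ) (hρ1 : ρ ≤ Real.sqrt 3 / 2) (hU : -(1/2) ≤ U) (hU1 : U ≤ 1/2)
    (hV : V ≠ 0) (hV1 : |V| ≤ ρ/2) : volume (Cset ρ U V) < ENNReal.ofReal (ρ/4) := by
  have hV0 : 0 < |V| := abs_pos.2 hV
  let D : ℝ → ℝ := fun x => (U^2+V^2-1/16)/2 + |x-1/2|/4 - U*(x-1/2)
  let f : ℝ → ℝ := fun x => cl (|V| * ρ) (|V| * ρ/2 - D x)/|V|
  have hcl := cl_cont (|V| * ρ)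
  have hfc : Continuous f := by
    have : Continuous D := by fun_prop
    fun_prop
  have hf0 : ∀ x, 0 ≤ f x := fun x => div_nonneg (le_max_left _ _) hV0.le
  have h1 : volume (Cset ρ U V) ≤ ∫⁻ x in Icc (0:ℝ) 1, ENNReal.ofReal (f x) := by
    rw [Measure.volume_eq_prod, Measure.prod_apply (Cset_meas ρ U V), ← lintegral_indicator measurableSet_Icc]
    apply lintegral_mono
    intro x
    by_cases hx : x ∈ Icc (0:ℝ) 1
    · rw [indicator_of_mem hx]
      refine le_trans (measure_mono ?_) (sliceBound ρ V (D x) hV)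
      rintro y ⟨_, h2, h3⟩
      exact ⟨h2, h3⟩
    · rw [indicator_of_notMem hx]
      have : Prod.mk x ⁻¹' Cset ρ U V = ∅ := by
        ext y
        simp only [mem_preimage, mem_empty_iff_false, iff_false]
        rintro ⟨h, _⟩
        exact hx h
      simp [this]
  refine lt_of_le_of_lt h1 ?_
  rw [← ofReal_integral_eq_lintegral_ofReal (hfc.integrableOn_Icc) (Filter.Eventually.of_forall hf0)]
  rw [ENNReal.ofReal_lt_ofReal_iff (by linarith), integral_Icc_eq_integral_Ioc,
    ← intervalIntegral.integral_of_le (by norm_num)]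
  rw [← intervalIntegral.integral_add_adjacent_intervals (b := 1/2) (hfc.intervalIntegrable _ _) (hfc.intervalIntegrable _ _)]
  have hVsq : |V|^2 = V^2 := sq_abs V
  have hR : ∫ x in (1/2:ℝ)..1, f x = JJ (|V| * ρ) (|V| * ρ/2 - (U^2+|V|^2-1/16)/2) (1/4-U) / |V| := by
    have := intervalIntegral.integral_comp_add_left (a := 0) (b := 1/2) f (1/2)
    rw [show (1/2:ℝ)+0 = 1/2 by norm_num, show (1/2:ℝ)+1/2 = 1 by norm_num] at this
    rw [← this, JJ, ← intervalIntegral.integral_div]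
    apply intervalIntegral.integral_congr
    intro x hx
    rw [uIcc_of_le (by norm_num)] at hx
    simp only [f, D]
    rw [show (1/2:ℝ)+x-1/2 = x by ring, abs_of_nonneg hx.1, hVsq]
    congr 2
    ring
  have hL : ∫ x in (0:ℝ)..(1/2), f x = JJ (|V| * ρ) (|V| * ρ/2 - (U^2+|V|^2-1/16)/2) (1/4+U) / |V| := by
    have := intervalIntegral.integral_comp_sub_left (a := 0) (b := 1/2) f (1/2)
    rw [show (1/2:ℝ)-0 = 1/2 by norm_num, show (1/2:ℝ)-1/2 = 0 by norm_num] at this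
    rw [← this, JJ, ← intervalIntegral.integral_div]
    apply intervalIntegral.integral_congr
    intro x hx
    rw [uIcc_of_le (by norm_num)] at hx
    simp only [f, D]
    rw [show (1/2:ℝ)-x-1/2 = -x by ring, abs_neg, abs_of_nonneg hx.1, hVsq]
    congr 2
    ring
  have := mainJ ρ U |V| hρ hρ1 hU hU1 hV0 hV1
  rw [hR, hL, ← add_div, div_lt_iff₀ hV0]
  linarith

/-- strips -/
lemma strip_vol (ρ a b : ℝ) (hρ : 0 < ρ) :
    volume (Icc a b ×ˢ Icc 0 ρ : Set (ℝ × ℝ)) = ENNReal.ofReal ((b-a)*ρ) := by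
  rw [Measure.volume_eq_prod, Measure.prod_prod, Real.volume_Icc, Real.volume_Icc, sub_zero,
    ← ENNReal.ofReal_mul' hρ.le]

lemma Cset_strip (ρ U : ℝ) (h1 : -(1/4) < U) (h2 : U < 1/4) :
    Cset ρ U 0 ⊆ Icc (1/2+(U-1/4)/2) (1/2+(U+1/4)/2) ×ˢ Icc 0 ρ := by
  rintro ⟨x, y⟩ ⟨_, hy, h⟩
  simp only at hy h
  refine ⟨⟨?_, ?_⟩, hy⟩
  · simp only
    have := neg_abs_le (x-1/2)
    have : (1/4+U) * ((U-1/4)/2) < (1/4+U) * (x-1/2) := by nlinarith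
    have := lt_of_mul_lt_mul_left this (by linarith)
    linarith
  · simp only
    have := le_abs_self (x-1/2)
    have : (1/4-U) * (x-1/2) < (1/4-U) * ((U+1/4)/2) := by nlinarith
    have := lt_of_mul_lt_mul_left this (by linarith)
    linarith

lemma Cset_vol_zero (ρ U : ℝ) (hρ : 0 < ρ) (h : U ≤ -(1/4) ∨ 1/4 ≤ U) :
    volume (Cset ρ U 0) < ENNReal.ofReal (ρ/4) := by
  by_cases hq : |U| = 1/4
  · have : Cset ρ U 0 = ∅ := by
      ext ⟨x, y⟩
      simp only [mem_empty_iff_false, iff_false]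
      rintro ⟨_, _, h'⟩
      simp only at h'
      have h1 : U * (x-1/2) ≤ |U| * |x-1/2| := by rw [← abs_mul]; exact le_abs_self _
      have h2 : U^2 = 1/16 := by rw [← sq_abs, hq]; norm_num
      rw [hq] at h1
      linarith
    rw [this]
    simp [hρ]
  replace h : U < -(1/4) ∨ 1/4 < U := by
    rcases h with h | h
    · refine Or.inl (lt_of_le_of_ne h ?_)
      rintro rfl
      exact hq (by norm_num [abs_of_pos])
    · refine Or.inr (lt_of_le_of_ne h ?_)
      rintro rfl
      exact hq (by norm_num [abs_of_pos])
  rcases h with h | h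
  · have : Cset ρ U 0 ⊆ Icc 0 (1/2+(-1/4+U)/2) ×ˢ Icc 0 ρ := by
      rintro ⟨x, y⟩ ⟨hx, hy, h'⟩
      simp only at hy h' hx
      have h1 := neg_abs_le (x-1/2)
      have h2 := le_abs_self (x-1/2)
      refine ⟨⟨hx.1, ?_⟩, hy⟩
      simp only
      by_contra hc
      push Not at hc
      nlinarith
    refine lt_of_le_of_lt (measure_mono this) ?_
    rw [strip_vol _ _ _ hρ, ENNReal.ofReal_lt_ofReal_iff (by linarith)]
    nlinarith
  · have : Cset ρ U 0 ⊆ Icc (1/2+(1/4+U)/2) 1 ×ˢ Icc 0 ρ := by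
      rintro ⟨x, y⟩ ⟨hx, hy, h'⟩
      simp only at hy h' hx
      have h1 := neg_abs_le (x-1/2)
      have h2 := le_abs_self (x-1/2)
      refine ⟨⟨?_, hx.2⟩, hy⟩
      simp only
      by_contra hc
      push Not at hc
      nlinarith
    refine lt_of_le_of_lt (measure_mono this) ?_
    rw [strip_vol _ _ _ hρ, ENNReal.ofReal_lt_ofReal_iff (by linarith)]
    nlinarith

def inSeg (U V : ℝ) : Prop := V = 0 ∧ -(1/4) < U ∧ U < 1/4

lemma Cset_lt (ρ U V : ℝ) (hρ : 0 < ρ) (hρ1 : ρ ≤ Real.sqrt 3 / 2) (hU : -(1/2) ≤ U) (hU1 : U ≤ 1/2)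
    (hV1 : |V| ≤ ρ/2) (h : ¬ inSeg U V) : volume (Cset ρ U V) < ENNReal.ofReal (ρ/4) := by
  by_cases hV : V = 0
  · subst hV
    apply Cset_vol_zero ρ U hρ
    by_contra hc
    push Not at hc
    exact h ⟨rfl, hc⟩
  · exact Cset_vol_pos ρ U V hρ hρ1 hU hU1 hV hV1

lemma Cset_seg (ρ U V : ℝ) (hρ : 0 < ρ) (h : inSeg U V) : volume (Cset ρ U V) ≤ ENNReal.ofReal (ρ/4) := by
  obtain ⟨rfl, h1, h2⟩ := h
  refine (measure_mono (Cset_strip ρ U h1 h2)).trans ?_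
  rw [strip_vol _ _ _ hρ]
  apply ENNReal.ofReal_le_ofReal
  linarith

lemma Cset_union (ρ U V U' V' : ℝ) (hρ : 0 < ρ) (hρ1 : ρ ≤ Real.sqrt 3 / 2)
    (hU : -(1/2) ≤ U) (hU1 : U ≤ 1/2) (hV1 : |V| ≤ ρ/2)
    (hU' : -(1/2) ≤ U') (hU1' : U' ≤ 1/2) (hV1' : |V'| ≤ ρ/2) (hne : U ≠ U' ∨ V ≠ V') :
    volume (Cset ρ U V ∪ Cset ρ U' V') < ENNReal.ofReal (ρ/2) := by
  have hsum : ENNReal.ofReal (ρ/2) = ENNReal.ofReal (ρ/4) + ENNReal.ofReal (ρ/4) := by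
    rw [← ENNReal.ofReal_add (by linarith) (by linarith)]; congr 1; ring
  by_cases h : inSeg U V
  · by_cases h' : inSeg U' V'
    · obtain ⟨rfl, h1, h2⟩ := h
      obtain ⟨rfl, h1', h2'⟩ := h'
      have hsub : Cset ρ U 0 ∪ Cset ρ U' 0 ⊆
          Icc (1/2+(min U U'-1/4)/2) (1/2+(max U U'+1/4)/2) ×ˢ Icc 0 ρ := by
        apply union_subset
        · refine (Cset_strip ρ U h1 h2).trans (prod_mono (Icc_subset_Icc ?_ ?_) subset_rfl)
          · linarith [min_le_left U U']
          · linarith [le_max_left U U']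
        · refine (Cset_strip ρ U' h1' h2').trans (prod_mono (Icc_subset_Icc ?_ ?_) subset_rfl)
          · linarith [min_le_right U U']
          · linarith [le_max_right U U']
      refine lt_of_le_of_lt (measure_mono hsub) ?_
      rw [strip_vol _ _ _ hρ, ENNReal.ofReal_lt_ofReal_iff (by linarith)]
      have : max U U' - min U U' < 1/2 := by
        rcases le_total U U' with h | h <;> simp [h] <;> linarith
      nlinarith
    · refine (measure_union_le _ _).trans_lt ?_
      rw [hsum]
      exact ENNReal.add_lt_add_of_le_of_lt ((Cset_seg ρ U V hρ h).trans_lt ENNReal.ofReal_lt_top).ne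
        (Cset_seg ρ U V hρ h) (Cset_lt ρ U' V' hρ hρ1 hU' hU1' hV1' h')
  · have hb := Cset_lt ρ U V hρ hρ1 hU hU1 hV1 h
    have hc : volume (Cset ρ U' V') ≤ ENNReal.ofReal (ρ/4) := by
      by_cases h' : inSeg U' V'
      · exact Cset_seg ρ U' V' hρ h'
      · exact (Cset_lt ρ U' V' hρ hρ1 hU' hU1' hV1' h').le
    refine (measure_union_le _ _).trans_lt ?_
    rw [hsum]
    exact ENNReal.add_lt_add_of_lt_of_le (hc.trans_lt ENNReal.ofReal_lt_top).ne hb hc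

lemma toPair_mp : MeasurePreserving (fun q : EuclideanSpace ℝ (Fin 2) => (q 0, q 1)) volume volume := by
  have h1 := EuclideanSpace.volume_preserving_symm_measurableEquiv_toLp (Fin 2)
  have h2 := volume_preserving_finTwoArrow ℝ
  exact h2.comp h1

lemma dist_lt_iff (q b w : EuclideanSpace ℝ (Fin 2)) (h : dist q b < dist q w) :
    (q 0 - b 0)^2 + (q 1 - b 1)^2 < (q 0 - w 0)^2 + (q 1 - w 1)^2 := by
  rw [EuclideanSpace.dist_eq, EuclideanSpace.dist_eq] at h
  have := (Real.sqrt_lt_sqrt_iff (by positivity)).1 h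
  simpa [Fin.sum_univ_two, Real.dist_eq, sq_abs] using this

lemma mem_Cset (ρ : ℝ) (W : Set (EuclideanSpace ℝ (Fin 2)))
    (hW : W = {pt (1/4) (ρ/2), pt (3/4) (ρ/2)}) (q b : EuclideanSpace ℝ (Fin 2)) (hq : q ∈ board ρ)
    (h : dist q b < infDist q W) : (q 0, q 1) ∈ Cset ρ (b 0 - 1/2) (b 1 - ρ/2) := by
  have h1 := dist_lt_iff q b (pt (1/4) (ρ/2)) (h.trans_le (infDist_le_dist_of_mem (by simp [hW])))
  have h2 := dist_lt_iff q b (pt (3/4) (ρ/2)) (h.trans_le (infDist_le_dist_of_mem (by simp [hW])))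
  refine ⟨hq.1, hq.2, ?_⟩
  simp only [pt, WithLp.equiv_symm_apply, PiLp.toLp_apply, Matrix.cons_val_zero, Matrix.cons_val_one] at h1 h2
  simp only
  rcases abs_cases (q 0 - 1/2) with ⟨h, _⟩ | ⟨h, _⟩ <;> rw [h] <;> nlinarith

/-- For `0 < ρ ≤ √3/2`, Wilma wins the two-point game with the `1 × 2` grid
`W = {(1/4, ρ/2), (3/4, ρ/2)}`: any two black points claim strictly less than
half the board. -/
theorem stmt_3 (ρ : ℝ) (hρ0 : 0 < ρ) (hρ1 : ρ ≤ Real.sqrt 3 / 2)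
    (W : Set (EuclideanSpace ℝ (Fin 2)))
    (hW : W = {pt (1/4) (ρ/2), pt (3/4) (ρ/2)})
    (B : Set (EuclideanSpace ℝ (Fin 2))) (hBQ : B ⊆ board ρ) (hBfin : B.Finite)
    (hBcard : B.ncard = 2) :
    volume {q | q ∈ board ρ ∧ infDist q B < infDist q W} < ENNReal.ofReal (ρ / 2) := by
  obtain ⟨b, c, hbc, hB⟩ := Set.ncard_eq_two.1 hBcard
  have hb : b ∈ board ρ := hBQ (by simp [hB])
  have hc : c ∈ board ρ := hBQ (by simp [hB])
  obtain ⟨⟨hb1, hb2⟩, hb3, hb4⟩ := hb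
  obtain ⟨⟨hc1, hc2⟩, hc3, hc4⟩ := hc
  have hsub : {q | q ∈ board ρ ∧ infDist q B < infDist q W} ⊆
      (fun q : EuclideanSpace ℝ (Fin 2) => (q 0, q 1)) ⁻¹'
        (Cset ρ (b 0 - 1/2) (b 1 - ρ/2) ∪ Cset ρ (c 0 - 1/2) (c 1 - ρ/2)) := by
    rintro q ⟨hq, hlt⟩
    obtain ⟨p, hp, hpd⟩ := hBfin.isCompact.exists_infDist_eq_dist ⟨b, by simp [hB]⟩ q
    rw [hpd] at hlt
    have := mem_Cset ρ W hW q p hq hlt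
    rw [hB] at hp
    rcases hp with rfl | hp
    · exact Or.inl this
    · rw [mem_singleton_iff] at hp
      subst hp
      exact Or.inr this
  refine (measure_mono hsub).trans_lt ?_
  rw [toPair_mp.measure_preimage ((Cset_meas _ _ _).union (Cset_meas _ _ _)).nullMeasurableSet]
  apply Cset_union ρ _ _ _ _ hρ0 hρ1 (by linarith) (by linarith) _ (by linarith) (by linarith)
  · rw [abs_le]; constructor <;> linarith
  · by_contra hcon
    push Not at hcon
    apply hbc
    ext i
    fin_cases i
    · simpa using hcon.1
    · simpa using hcon.2
  · rw [abs_le]; constructor <;> linarith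
end

section
/- Let Q ⊆ ℝ² be a compact convex set with μ(Q) > 0, let W ⊆ Q be a finite nonempty set with |W| = n, and for w ∈ W let C(w) = {q ∈ Q : dist(q, w) ≤ dist(q, w') for all w' ∈ W} be the Voronoi cell of w in Q. If there exists w ∈ W such that C(w) is not point symmetric (i.e., there is no point c ∈ ℝ² with: q ∈ C(w) ⟺ 2c − q ∈ C(w) for all q ∈ ℝ²), then there exists a finite set B ⊆ Q with |B| = n such that μ({q ∈ Q : infDist(q, B) < infDist(q, W)}) > μ(Q)/2. -/
open MeasureTheory Metric Set
open scoped ENNReal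

/-- The Voronoi cell of `w` in the board `Q` with respect to the site set `W`:
the points of `Q` at least as close to `w` as to every other site. -/
def cell (Q W : Set (EuclideanSpace ℝ (Fin 2))) (w : EuclideanSpace ℝ (Fin 2)) :
    Set (EuclideanSpace ℝ (Fin 2)) :=
  {q | q ∈ Q ∧ ∀ w' ∈ W, dist q w ≤ dist q w'}

/-- A set `C` is point symmetric about `c` if it is invariant under the point
reflection `q ↦ 2c − q`. -/
def PointSymmetricAbout (C : Set (EuclideanSpace ℝ (Fin 2)))
    (c : EuclideanSpace ℝ (Fin 2)) : Prop :=
  ∀ q, q ∈ C ↔ (2 : ℝ) • c - q ∈ C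

local notation "E2" => EuclideanSpace ℝ (Fin 2)

lemma null_line (w v : E2) (hv : v ≠ 0) : volume {x : E2 | inner ℝ (x - w) v = 0} = 0 := by
  have h := Measure.addHaar_affineSubspace (volume : Measure E2)
    (AffineSubspace.perpBisector (w - v) (w + v)) (by
      rw [Ne, AffineSubspace.perpBisector_eq_top]
      intro h
      apply hv
      have h2 : (2 : ℝ) • v = 0 := by
        rw [two_smul]
        have := congrArg (fun z => z - w + v) h
        simp at this
        simpa using this.symm
      simpa using h2)
  refine measure_mono_null ?_ h
  intro x hx
  simp only [mem_ofPred_eq] at hx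
  rw [SetLike.mem_coe, AffineSubspace.mem_perpBisector_iff_dist_eq, dist_eq_norm, dist_eq_norm]
  have e1 : x - (w - v) = (x - w) + v := by abel
  have e2 : x - (w + v) = (x - w) - v := by abel
  rw [e1, e2, ← sq_eq_sq₀ (norm_nonneg _) (norm_nonneg _), norm_add_sq_real,
    norm_sub_sq_real (x - w) v, hx]
  ring

lemma half_ge (C : Set E2) (hC : IsCompact C) (w v : E2) (hv : v ≠ 0) :
    volume.real C = volume.real (C ∩ {x | 0 < inner ℝ (x - w) v})
      + volume.real (C ∩ {x | inner ℝ (x - w) v < 0}) := by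
  have hm : MeasurableSet {x : E2 | 0 < inner ℝ (x - w) v} :=
    (isOpen_lt continuous_const (by fun_prop)).measurableSet
  have h1 := measureReal_inter_add_sdiff (μ := volume) (s := C) hm hC.measure_lt_top.ne
  rw [← h1]
  congr 1
  apply measureReal_congr
  rw [ae_eq_set]
  constructor
  · refine measure_mono_null ?_ (null_line w v hv)
    rintro x ⟨⟨hx, hx1⟩, hx2⟩
    simp only [mem_ofPred_eq, not_lt, mem_inter_iff, not_and] at *
    exact le_antisymm hx1 (hx2 hx)
  · convert measure_empty (μ := (volume : Measure E2))
    ext x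
    simp only [mem_sdiff, mem_inter_iff, mem_ofPred_eq, mem_empty_iff_false, iff_false]
    rintro ⟨⟨hx, hx1⟩, hx2⟩
    exact hx2 ⟨hx, by linarith⟩

lemma inter_split (C : Set E2) (hC : IsCompact C) (w v : E2) (hv : v ≠ 0) (A : Set E2) :
    volume.real (C ∩ A) = volume.real (C ∩ A ∩ {x | 0 < inner ℝ (x - w) v})
      + volume.real (C ∩ A ∩ {x | inner ℝ (x - w) v < 0}) := by
  have hm : MeasurableSet {x : E2 | 0 < inner ℝ (x - w) v} :=
    (isOpen_lt continuous_const (by fun_prop)).measurableSet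
  have h1 := measureReal_inter_add_sdiff (μ := volume) (s := C ∩ A) hm
    ((measure_mono inter_subset_left).trans_lt hC.measure_lt_top).ne
  rw [← h1]
  congr 1
  apply measureReal_congr
  rw [ae_eq_set]
  constructor
  · refine measure_mono_null ?_ (null_line w v hv)
    rintro x ⟨⟨hx, hx1⟩, hx2⟩
    have hx1 : ¬ (0 < inner ℝ (x - w) v) := hx1
    have hx2 : ¬ (inner ℝ (x - w) v < 0) := fun h => hx2 ⟨hx, h⟩
    exact le_antisymm (not_lt.1 hx1) (not_lt.1 hx2)
  · convert measure_empty (μ := (volume : Measure E2))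
    ext x
    simp only [mem_sdiff, mem_inter_iff, mem_ofPred_eq, mem_empty_iff_false, iff_false]
    rintro ⟨⟨hx, hx1⟩, hx2⟩
    exact hx2 ⟨hx, by linarith⟩

lemma wedge_eq (C : Set E2) (hC : IsCompact C) (w : E2)
    (h : ∀ v : E2, v ≠ 0 → volume.real (C ∩ {x | 0 < inner ℝ (x - w) v}) ≤ volume.real C / 2)
    (u v : E2) (hu : u ≠ 0) (hv : v ≠ 0) :
    volume.real (C ∩ {x | 0 < inner ℝ (x - w) u} ∩ {x | inner ℝ (x - w) v < 0}) =
    volume.real (C ∩ {x | 0 < inner ℝ (x - w) v} ∩ {x | inner ℝ (x - w) u < 0}) := by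
  have key : ∀ v : E2, v ≠ 0 →
      volume.real (C ∩ {x | 0 < inner ℝ (x - w) v}) = volume.real C / 2 := by
    intro v hv
    have h1 := half_ge C hC w v hv
    have h2 := h (-v) (neg_ne_zero.2 hv)
    simp only [inner_neg_right, Left.neg_pos_iff] at h2
    have h3 := h v hv
    linarith
  have h1 := inter_split C hC w v hv {x | 0 < inner ℝ (x - w) u}
  have h2 := inter_split C hC w u hu {x | 0 < inner ℝ (x - w) v}
  rw [key u hu] at h1
  rw [key v hv, inter_right_comm] at h2
  linarith

lemma decomp (p j z : E2) (hj0 : j 0 = - p 1) (hj1 : j 1 = p 0)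
    (hN : 0 < p 0 ^ 2 + p 1 ^ 2)
    (hin : ∀ x y : E2, inner ℝ x y = x 0 * y 0 + x 1 * y 1) :
    ∃ α β : ℝ, inner ℝ z p = α * (p 0 ^ 2 + p 1 ^ 2) ∧ inner ℝ z j = β * (p 0 ^ 2 + p 1 ^ 2) ∧
      z = α • p + β • j := by
  obtain ⟨α, hα⟩ : ∃ α, α = inner ℝ z p / (p 0 ^ 2 + p 1 ^ 2) := ⟨_, rfl⟩
  obtain ⟨β, hβ⟩ : ∃ β, β = inner ℝ z j / (p 0 ^ 2 + p 1 ^ 2) := ⟨_, rfl⟩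
  have hα' : inner ℝ z p = α * (p 0 ^ 2 + p 1 ^ 2) := by rw [hα, div_mul_cancel₀ _ hN.ne']
  have hβ' : inner ℝ z j = β * (p 0 ^ 2 + p 1 ^ 2) := by rw [hβ, div_mul_cancel₀ _ hN.ne']
  refine ⟨α, β, hα', hβ', ?_⟩
  rw [hin] at hα' hβ'
  rw [hj0, hj1] at hβ'
  have g0 : z 0 = α * p 0 + β * j 0 := by
    rw [hj0]
    apply mul_right_cancel₀ hN.ne'
    linear_combination p 0 * hα' - p 1 * hβ'
  have g1 : z 1 = α * p 1 + β * j 1 := by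
    rw [hj1]
    apply mul_right_cancel₀ hN.ne'
    linear_combination p 1 * hα' + p 0 * hβ'
  ext i
  fin_cases i
  · simpa using g0
  · simpa using g1

set_option maxHeartbeats 1000000 in
lemma sym_key (C : Set E2) (hC : IsCompact C) (hconv : Convex ℝ C) (w : E2) (hw : w ∈ C)
    (hint : (interior C).Nonempty)
    (h : ∀ v : E2, v ≠ 0 → volume.real (C ∩ {x | 0 < inner ℝ (x - w) v}) ≤ volume.real C / 2) :
    PointSymmetricAbout C w := by
  have main : ∀ q ∈ C, (2 : ℝ) • w - q ∈ C := by
    intro q0 hq0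
    by_contra hq0'
    have hcl : q0 ∈ closure (interior C) := by
      rw [hconv.closure_interior_eq_closure_of_nonempty_interior hint]
      exact subset_closure hq0
    have hopen : IsOpen {x : E2 | (2 : ℝ) • w - x ∉ C} :=
      hC.isClosed.isOpen_compl.preimage (by fun_prop)
    obtain ⟨q, hqN, hqI⟩ := mem_closure_iff.1 hcl _ hopen hq0'
    have hO : IsOpen ({x : E2 | (2 : ℝ) • w - x ∉ C} ∩ interior C) := hopen.inter isOpen_interior
    obtain ⟨δ, hδ, hball⟩ := Metric.isOpen_iff.1 hO q ⟨hqN, hqI⟩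
    obtain ⟨p, hp⟩ : ∃ p, p = q - w := ⟨_, rfl⟩
    have hp0 : p ≠ 0 := by
      rintro rfl
      have : q = w := (sub_eq_zero.1 hp.symm)
      subst this
      apply hqN
      simpa [two_smul] using hw
    obtain ⟨j, hj⟩ : ∃ j : E2, j = !₂[-p 1, p 0] := ⟨_, rfl⟩
    have hj0 : j 0 = - p 1 := by simp [hj]
    have hj1 : j 1 = p 0 := by simp [hj]
    have hN : 0 < p 0 ^ 2 + p 1 ^ 2 := by
      have := norm_pos_iff.2 hp0
      have h2 := EuclideanSpace.norm_sq_eq p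
      simp at h2
      rw [← h2]; positivity
    have hin : ∀ x y : E2, inner ℝ x y = x 0 * y 0 + x 1 * y 1 := by
      intro x y
      simp [PiLp.inner_apply, mul_comm]
    have hpn : 0 < ‖p‖ := norm_pos_iff.2 hp0
    have hjn : ‖j‖ = ‖p‖ := by
      rw [EuclideanSpace.norm_eq, EuclideanSpace.norm_eq]
      simp [hj0, hj1, add_comm]
    obtain ⟨ε, hε, hε2⟩ : ∃ ε : ℝ, 0 < ε ∧ ε * ‖p‖ < δ :=
      ⟨δ / (2 * ‖p‖), by positivity, by field_simp; linarith⟩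
    obtain ⟨u, hu⟩ : ∃ u, u = j + ε • p := ⟨_, rfl⟩
    obtain ⟨v, hv⟩ : ∃ v, v = j - ε • p := ⟨_, rfl⟩
    have hu0 : u 0 = - p 1 + ε * p 0 := by simp [hu, hj0]
    have hu1 : u 1 = p 0 + ε * p 1 := by simp [hu, hj1]
    have hv0 : v 0 = - p 1 - ε * p 0 := by simp [hv, hj0]
    have hv1 : v 1 = p 0 - ε * p 1 := by simp [hv, hj1]
    have hpu : 0 < inner ℝ p u := by
      rw [hin, hu0, hu1]
      nlinarith [mul_pos hε hN]
    have hpv : inner ℝ p v < 0 := by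
      rw [hin, hv0, hv1]
      nlinarith [mul_pos hε hN]
    have hune : u ≠ 0 := by rintro rfl; simp at hpu
    have hvne : v ≠ 0 := by rintro rfl; simp at hpv
    have hw1 := wedge_eq C hC w h u v hune hvne
    set S : Set E2 := {x | 0 < inner ℝ (x - w) u} ∩ {x | inner ℝ (x - w) v < 0} with hS
    have hSo : IsOpen S := (isOpen_lt continuous_const (by fun_prop)).inter
      (isOpen_lt (by fun_prop) continuous_const)
    set C' : Set E2 := {x | (2 : ℝ) • w - x ∈ C} with hC'
    have hC'c : IsClosed C' := hC.isClosed.preimage (by fun_prop)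
    have hrefl : volume (C' ∩ S) =
        volume (C ∩ {x | 0 < inner ℝ (x - w) v} ∩ {x | inner ℝ (x - w) u < 0}) := by
      have hmp := Measure.measurePreserving_sub_left (volume : Measure E2) ((2 : ℝ) • w)
      have hms : MeasurableSet
          (C ∩ {x | 0 < inner ℝ (x - w) v} ∩ {x | inner ℝ (x - w) u < 0}) :=
        (hC.isClosed.measurableSet.inter
          (isOpen_lt continuous_const (by fun_prop)).measurableSet).inter
          (isOpen_lt (by fun_prop) continuous_const).measurableSet
      rw [← hmp.measure_preimage hms.nullMeasurableSet]
      · congr 1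
        ext x
        have e : (2 : ℝ) • w - x - w = - (x - w) := by rw [two_smul]; abel
        simp only [hC', hS, mem_inter_iff, mem_ofPred_eq, mem_preimage, e, inner_neg_left,
          Left.neg_pos_iff, Left.neg_neg_iff]
        try rw [sub_sub_cancel]
        tauto
    have hcone : ∀ x ∈ S, ∃ a : ℝ, 0 < a ∧ ∃ y ∈ ball q δ, x - w = a • (y - w) := by
      rintro x ⟨hx1, hx2⟩
      have hx1 : 0 < inner ℝ (x - w) u := hx1
      have hx2 : inner ℝ (x - w) v < 0 := hx2
      obtain ⟨z, hz⟩ : ∃ z, z = x - w := ⟨_, rfl⟩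
      rw [← hz] at hx1 hx2 ⊢
      obtain ⟨α, β, hα', hβ', hzd⟩ := decomp p j z hj0 hj1 hN hin
      rw [hu, inner_add_right, inner_smul_right, hα', hβ'] at hx1
      rw [hv, inner_sub_right, inner_smul_right, hα', hβ'] at hx2
      have hx1' : 0 < β + ε * α := by
        by_contra hh
        nlinarith
      have hx2' : β - ε * α < 0 := by
        by_contra hh
        nlinarith
      have hαp : 0 < α := by
        by_contra hh
        nlinarith
      refine ⟨α, hαp, q + (β / α) • j, ?_, ?_⟩
      · rw [mem_ball, dist_eq_norm, add_sub_cancel_left, norm_smul, hjn]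
        have : ‖β / α‖ ≤ ε := by
          rw [Real.norm_eq_abs, abs_div, abs_of_pos hαp, div_le_iff₀ hαp, abs_le]
          constructor <;> linarith
        calc ‖β / α‖ * ‖p‖ ≤ ε * ‖p‖ := by gcongr
          _ < δ := hε2
      · have : q + (β / α) • j - w = p + (β / α) • j := by rw [hp]; abel
        rw [this, smul_add, smul_smul, mul_div_cancel₀ _ hαp.ne', hzd]
    have hconv' : Convex ℝ C' := by
      intro x hx y hy a b ha hb hab
      have := hconv hx hy ha hb hab
      show (2 : ℝ) • w - (a • x + b • y) ∈ C
      convert this using 1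
      have hb' : b = 1 - a := by linarith
      subst hb'
      module
    have hwC' : w ∈ C' := by
      show (2 : ℝ) • w - w ∈ C
      simpa [two_smul] using hw
    have hsub : C' ∩ S ⊆ C ∩ S := by
      rintro x ⟨hxC, hxS⟩
      refine ⟨?_, hxS⟩
      obtain ⟨a, ha, y, hy, hxy⟩ := hcone x hxS
      have hyb := hball hy
      have hxe : x = w + a • (y - w) := by rw [← hxy]; abel
      rcases le_or_gt a 1 with ha1 | ha1
      · rw [hxe]
        exact hconv.add_smul_sub_mem hw (interior_subset hyb.2) ⟨ha.le, ha1⟩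
      · exfalso
        apply hyb.1
        have hye : y = w + a⁻¹ • (x - w) := by
          rw [hxy, smul_smul, inv_mul_cancel₀ ha.ne', one_smul]; abel
        have : y ∈ C' := by
          rw [hye]
          exact hconv'.add_smul_sub_mem hwC' hxC ⟨by positivity, inv_le_one_of_one_le₀ ha1.le⟩
        exact this
    have hpos : 0 < volume (ball q δ ∩ S) := by
      refine (isOpen_ball.inter hSo).measure_pos volume ?_
      refine ⟨q, mem_ball_self hδ, ?_, ?_⟩
      · show 0 < inner ℝ (q - w) u
        rwa [← hp]
      · show inner ℝ (q - w) v < 0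
        rwa [← hp]
    have hfin : volume (C ∩ S) ≠ ⊤ :=
      ((measure_mono inter_subset_left).trans_lt hC.measure_lt_top).ne
    have hle : volume (C' ∩ S) + volume (ball q δ ∩ S) ≤ volume (C ∩ S) := by
      rw [← measure_union _ (isOpen_ball.inter hSo).measurableSet]
      · apply measure_mono
        apply union_subset hsub
        exact fun x hx => ⟨interior_subset (hball hx.1).2, hx.2⟩
      · rw [Set.disjoint_left]
        rintro x ⟨hx, -⟩ ⟨hx2, -⟩
        exact (hball hx2).1 hx
    have heq : volume (C' ∩ S) = volume (C ∩ S) := by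
      rw [hrefl, hS, ← inter_assoc]
      rw [measureReal_def, measureReal_def] at hw1
      refine ((ENNReal.toReal_eq_toReal_iff' ?_ ?_).1 hw1).symm <;>
      · rw [inter_assoc]
        exact ((measure_mono inter_subset_left).trans_lt hC.measure_lt_top).ne
    rw [heq] at hle
    have := ENNReal.lt_add_right hfin hpos.ne'
    exact absurd hle (not_le.2 this)
  intro q
  refine ⟨main q, fun hq => ?_⟩
  have := main _ hq
  simpa using this

lemma proj_key (Q : Set E2) (hQc : IsCompact Q) (hQconv : Convex ℝ Q) (w : E2) (hw : w ∈ Q)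
    (v : E2) : ∃ b : ℕ → E2, (∀ k, b k ∈ Q) ∧ Filter.Tendsto b Filter.atTop (nhds w) ∧
      ∀ q ∈ Q, 0 < inner ℝ (q - w) v → ∀ᶠ k in Filter.atTop, dist q (b k) < dist q w := by
  have hex : ∀ k : ℕ, ∃ b ∈ Q, ∀ q ∈ Q,
      inner ℝ (w + ((1 : ℝ) / (k + 1)) • v - b) (q - b) ≤ 0 := by
    intro k
    obtain ⟨b, hb, hb2⟩ := exists_norm_eq_iInf_of_complete_convex ⟨w, hw⟩ hQc.isComplete hQconv
      (w + ((1 : ℝ) / (k + 1)) • v)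
    exact ⟨b, hb, (norm_eq_iInf_iff_real_inner_le_zero hQconv hb).1 hb2⟩
  choose b hbQ hb using hex
  have ht0 : Filter.Tendsto (fun k : ℕ => (1 : ℝ) / (k + 1)) Filter.atTop (nhds 0) :=
    tendsto_one_div_add_atTop_nhds_zero_nat
  have hnorm : ∀ k, ‖b k - w‖ ≤ (1 : ℝ) / (k + 1) * ‖v‖ := by
    intro k
    have h1 := hb k w hw
    have ht : (0 : ℝ) < 1 / (k + 1) := by positivity
    generalize (1 : ℝ) / (k + 1) = t at *
    have e1 : w + t • v - b k = t • v - (b k - w) := by abel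
    have e2 : w - b k = -(b k - w) := by abel
    rw [e1, e2, inner_neg_right, inner_sub_left, inner_smul_left, real_inner_self_eq_norm_sq] at h1
    have h2 := real_inner_le_norm v (b k - w)
    simp at h1
    by_contra hh
    have : 0 < ‖b k - w‖ := lt_of_le_of_lt (by positivity) (not_le.1 hh)
    nlinarith
  have htend : Filter.Tendsto b Filter.atTop (nhds w) := by
    rw [tendsto_iff_norm_sub_tendsto_zero]
    refine squeeze_zero (fun _ => norm_nonneg _) hnorm ?_
    simpa using ht0.mul_const ‖v‖
  refine ⟨b, hbQ, htend, ?_⟩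
  intro q hq hqv
  have hlim : Filter.Tendsto (fun k => inner ℝ (q - b k) v) Filter.atTop
      (nhds (inner ℝ (q - w) v)) := (tendsto_const_nhds.sub htend).inner tendsto_const_nhds
  filter_upwards [hlim.eventually (lt_mem_nhds hqv)] with k hk
  have h1 := hb k q hq
  have ht : (0 : ℝ) < 1 / (k + 1) := by positivity
  generalize (1 : ℝ) / (k + 1) = t at *
  have e1 : w + t • v - b k = t • v - (b k - w) := by abel
  rw [e1, inner_sub_left, inner_smul_left, real_inner_comm] at h1
  simp at h1
  have h2 := mul_pos ht hk
  have h3 : 0 < inner ℝ (b k - w) (q - b k) := by linarith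
  have e3 : q - w = (b k - w) + (q - b k) := by abel
  rw [dist_eq_norm, dist_eq_norm]
  refine lt_of_pow_lt_pow_left₀ 2 (norm_nonneg _) ?_
  rw [e3, norm_add_sq_real]
  nlinarith [sq_nonneg ‖b k - w‖]

lemma cell_compact (Q W : Set E2) (hQc : IsCompact Q) (w : E2) : IsCompact (cell Q W w) := by
  have : cell Q W w = Q ∩ ⋂ w' ∈ W, {q | dist q w ≤ dist q w'} := by
    ext x; simp [cell]
  rw [this]
  refine hQc.inter_right (isClosed_biInter fun w' _ => isClosed_le (by fun_prop) (by fun_prop))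

lemma cell_convex (Q W : Set E2) (hQ : Convex ℝ Q) (w : E2) : Convex ℝ (cell Q W w) := by
  have : cell Q W w = Q ∩ ⋂ w' ∈ W, {q | inner ℝ (w' - w) q ≤ (‖w'‖ ^ 2 - ‖w‖ ^ 2) / 2} := by
    ext x
    simp only [cell, mem_ofPred_eq, mem_inter_iff, mem_iInter]
    refine and_congr_right fun _ => forall₂_congr fun w' _ => ?_
    rw [dist_eq_norm, dist_eq_norm, ← sq_le_sq₀ (norm_nonneg _) (norm_nonneg _),
      norm_sub_sq_real, norm_sub_sq_real, inner_sub_left, real_inner_comm, real_inner_comm x w']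
    constructor <;> intro h <;> linarith
  rw [this]
  refine hQ.inter (convex_iInter₂ fun w' _ => ?_)
  exact convex_halfSpace_le (innerₛₗ ℝ (w' - w)).isLinear _

lemma cell_interior (Q W : Set E2) (hQ : Convex ℝ Q) (hQvol : 0 < volume Q) (hW : W.Finite)
    (w : E2) (hw : w ∈ Q) (hwW : w ∈ W) : (interior (cell Q W w)).Nonempty := by
  have hint : (interior Q).Nonempty := by
    rw [nonempty_iff_ne_empty]
    intro h
    have h1 := hQ.addHaar_frontier (volume : Measure E2)
    have : Q ⊆ frontier Q := by
      rw [frontier, h, sdiff_empty]; exact subset_closure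
    exact hQvol.ne' (measure_mono_null this h1)
  have hcl : w ∈ closure (interior Q) := by
    rw [hQ.closure_interior_eq_closure_of_nonempty_interior hint]
    exact subset_closure hw
  have hO : IsOpen (⋂ w' ∈ W \ {w}, {q : E2 | dist q w < dist q w'}) :=
    (hW.subset sdiff_subset).isOpen_biInter fun w' _ => isOpen_lt (by fun_prop) (by fun_prop)
  obtain ⟨y, hy1, hy2⟩ := mem_closure_iff.1 hcl _ hO (by
    simp only [mem_iInter, mem_ofPred_eq, dist_self]
    intro w' hw'
    exact dist_pos.2 (fun h => hw'.2 h.symm))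
  refine ⟨y, mem_interior.2 ⟨_, ?_, hO.inter isOpen_interior, hy1, hy2⟩⟩
  rintro x ⟨hx1, hx2⟩
  refine ⟨interior_subset hx2, fun w' hw' => ?_⟩
  by_cases h : w' = w
  · rw [h]
  · simp only [mem_iInter] at hx1
    exact (hx1 w' ⟨hw', h⟩).le

/-- If some Voronoi cell of Wilma's placement `W` in a compact convex board `Q`
of positive area is not point symmetric, then Barney wins: some `n`-point set
`B ⊆ Q` claims strictly more than half the area of `Q`. -/
theorem stmt_5 (Q : Set (EuclideanSpace ℝ (Fin 2))) (hQc : IsCompact Q) (hQconv : Convex ℝ Q)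
    (hQvol : 0 < volume Q) (n : ℕ)
    (W : Set (EuclideanSpace ℝ (Fin 2))) (hWQ : W ⊆ Q) (hWfin : W.Finite)
    (hWne : W.Nonempty) (hWcard : W.ncard = n)
    (hasym : ∃ w ∈ W, ¬ ∃ c, PointSymmetricAbout (cell Q W w) c) :
    ∃ B : Set (EuclideanSpace ℝ (Fin 2)), B ⊆ Q ∧ B.Finite ∧ B.ncard = n ∧
      volume {q | q ∈ Q ∧ infDist q B < infDist q W} > volume Q / 2 := by
  obtain ⟨w0, hw0, hns⟩ := hasym
  have hfin : ∀ w, volume (cell Q W w) ≠ ⊤ := fun w => (cell_compact Q W hQc w).measure_lt_top.ne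
  have hexv : ∀ w, ∃ v : E2, (w ∈ W →
      volume.real (cell Q W w) / 2 ≤ volume.real (cell Q W w ∩ {x | 0 < inner ℝ (x - w) v})) ∧
      (w = w0 → volume.real (cell Q W w) / 2 <
        volume.real (cell Q W w ∩ {x | 0 < inner ℝ (x - w) v})) := by
    intro w
    by_cases hww : w = w0
    · subst hww
      by_contra hcon
      push Not at hcon
      apply hns
      refine ⟨w, sym_key _ (cell_compact Q W hQc w) (cell_convex Q W hQconv w) w
        ⟨hWQ hw0, fun w' _ => by simp⟩
        (cell_interior Q W hQconv hQvol hWfin w (hWQ hw0) hw0) ?_⟩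
      intro v _
      by_contra hlt
      have := (hcon v (fun _ => (not_le.1 hlt).le)).2
      exact hlt this
    · obtain ⟨v, hv⟩ : ∃ v : E2, v ≠ 0 := exists_ne 0
      have h1 := half_ge _ (cell_compact Q W hQc w) w v hv
      rcases le_total (volume.real (cell Q W w) / 2)
        (volume.real (cell Q W w ∩ {x | 0 < inner ℝ (x - w) v})) with h | h
      · exact ⟨v, fun _ => h, fun h => absurd h hww⟩
      · refine ⟨-v, fun _ => ?_, fun h => absurd h hww⟩
        simp only [inner_neg_right, Left.neg_pos_iff]
        linarith
  choose v hv hv0 using hexv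
  have hexb := fun w : W => proj_key Q hQc hQconv w (hWQ w.2) (v w)
  choose b hbQ hbt hbc using hexb
  have : Fintype W := hWfin.fintype
  obtain ⟨D, hD⟩ : ∃ D : W → Set E2,
    D = fun w : W => cell Q W w ∩ {x | 0 < inner ℝ (x - (w : E2)) (v w)} := ⟨_, rfl⟩
  have hDfin : ∀ w, volume (D w) ≠ ⊤ := fun w => by
    rw [hD]; exact ((measure_mono inter_subset_left).trans_lt (hfin w).lt_top).ne
  have hDm : ∀ w, MeasurableSet (D w) := fun w => by
    rw [hD]
    exact (cell_compact Q W hQc w).isClosed.measurableSet.inter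
      (isOpen_lt continuous_const (by fun_prop)).measurableSet
  have hdisj : Pairwise (Function.onFun (AEDisjoint volume) D) := by
    intro w w' hne
    refine measure_mono_null ?_ (Measure.addHaar_affineSubspace (volume : Measure E2)
      (AffineSubspace.perpBisector (w : E2) w') ?_)
    · rintro x ⟨hx1, hx2⟩
      rw [hD] at hx1 hx2
      rw [SetLike.mem_coe, AffineSubspace.mem_perpBisector_iff_dist_eq]
      exact le_antisymm (hx1.1.2 _ w'.2) (hx2.1.2 _ w.2)
    · rw [Ne, AffineSubspace.perpBisector_eq_top]
      exact fun h => hne (Subtype.ext h)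
  have hcover : Q ⊆ ⋃ w : W, cell Q W w := by
    intro q hq
    obtain ⟨w, hw, hmin⟩ := Set.exists_min_image W (fun w => dist q w) hWfin hWne
    exact mem_iUnion.2 ⟨⟨w, hw⟩, hq, hmin⟩
  have hmeas : volume Q / 2 < volume (⋃ w, D w) := by
    rw [measure_iUnion₀ hdisj (fun w => (hDm w).nullMeasurableSet), tsum_fintype]
    have h1 : volume Q ≤ ∑ w : W, volume (cell Q W w) :=
      (measure_mono hcover).trans (measure_iUnion_fintype_le _ _)
    have h2 : (∑ w : W, volume.real (cell Q W w)) / 2 < ∑ w : W, volume.real (D w) := by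
      rw [Finset.sum_div]
      refine Finset.sum_lt_sum (fun w _ => ?_) ⟨⟨w0, hw0⟩, Finset.mem_univ _, ?_⟩
      · rw [hD]; exact hv w w.2
      · rw [hD]; exact hv0 w0 rfl
    have h3 : volume.real Q ≤ ∑ w : W, volume.real (cell Q W w) := by
      have := ENNReal.toReal_mono
        (ENNReal.sum_ne_top.2 fun (w : W) _ => hfin (w : E2)) h1
      rwa [ENNReal.toReal_sum (fun (w : W) _ => hfin (w : E2))] at this
    rw [← ENNReal.toReal_lt_toReal, ENNReal.toReal_sum (fun w _ => hDfin w), ENNReal.toReal_div]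
    · simp only [measureReal_def] at h2 h3
      simp only [ENNReal.toReal_ofNat]
      linarith
    · exact ENNReal.div_ne_top hQc.measure_lt_top.ne (by norm_num)
    · exact ENNReal.sum_ne_top.2 fun w _ => hDfin w
  obtain ⟨A, hA⟩ : ∃ A : ℕ → Set E2, A = fun k =>
    {q | q ∈ Q ∧ infDist q (range fun w => b w k) < infDist q W} := ⟨_, rfl⟩
  have hsub : (⋃ w, D w) ⊆ ⋃ N, ⋂ k ≥ N, A k := by
    intro q hq
    obtain ⟨w, hq⟩ := mem_iUnion.1 hq
    rw [hD] at hq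
    obtain ⟨hqc, hqv⟩ := hq
    obtain ⟨N, hN⟩ := Filter.eventually_atTop.1 (hbc w q hqc.1 hqv)
    refine mem_iUnion.2 ⟨N, mem_iInter₂.2 fun k hk => ?_⟩
    rw [hA]
    refine ⟨hqc.1, ?_⟩
    calc infDist q (range fun w => b w k) ≤ dist q (b w k) := infDist_le_dist_of_mem ⟨w, rfl⟩
      _ < dist q w := hN k hk
      _ ≤ infDist q W := (le_infDist hWne).2 fun {y} hy => hqc.2 y hy
  have hmono : Monotone fun N => ⋂ k ≥ N, A k := by
    intro N M hNM
    exact biInter_subset_biInter_left fun k hk => le_trans hNM hk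
  have hsup := hmeas.trans_le (measure_mono hsub)
  rw [hmono.measure_iUnion, lt_iSup_iff] at hsup
  obtain ⟨N, hN⟩ := hsup
  have hinj : ∀ᶠ k in Filter.atTop, ∀ w w' : W, w ≠ w' → b w k ≠ b w' k := by
    rw [Filter.eventually_all]; intro w
    rw [Filter.eventually_all]; intro w'
    by_cases h : w = w'
    · exact Filter.Eventually.of_forall fun _ h' => absurd h h'
    · have := ((hbt w).prodMk_nhds (hbt w')).eventually
        (isOpen_ne_fun (continuous_fst (X := E2) (Y := E2)) continuous_snd |>.mem_nhds
          (fun h' => h (Subtype.ext h')))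
      filter_upwards [this] with k hk _ using hk
  obtain ⟨k, hk, hkN⟩ := (hinj.and (Filter.eventually_ge_atTop N)).exists
  refine ⟨range fun w => b w k, ?_, finite_range _, ?_, ?_⟩
  · rintro _ ⟨w, rfl⟩; exact hbQ w k
  · have hi : Function.Injective fun w => b w k := by
      intro w w' h
      by_contra hne
      exact hk w w' hne h
    rw [← image_univ, ncard_image_of_injective _ hi, ncard_univ, ← hWcard]
    rfl
  · have := hN.trans_le (measure_mono (biInter_subset_of_mem (s := {k | k ≥ N}) hkN))
    rw [hA] at this
    exact this
end

section
/- Let 0 < ρ ≤ 1, let n ≥ 1, and let W ⊆ Q be a finite set with |W| = n. Suppose that for every finite set B ⊆ Q with |B| = n one has μ({q ∈ Q : infDist(q, B) < infDist(q, W)}) ≤ ρ/2 (i.e., Barney cannot win against W). Then the Voronoi diagram of W is a regular grid: there exist natural numbers k, m with k·m = n such that W = {((2i−1)/(2k), (2j−1)·ρ/(2m)) : 1 ≤ i ≤ k, 1 ≤ j ≤ m}. -/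
open MeasureTheory Metric Set
open scoped ENNReal

namespace VG
open Filter Topology

def dsq (p q : ℝ × ℝ) : ℝ := (p.1 - q.1) ^ 2 + (p.2 - q.2) ^ 2

def cel (A C : ℝ) (W : Set (ℝ × ℝ)) (w q : ℝ × ℝ) : Prop :=
  0 ≤ q.1 ∧ q.1 ≤ A ∧ 0 ≤ q.2 ∧ q.2 ≤ C ∧ ∀ w' ∈ W, dsq q w ≤ dsq q w'

structure Good (A C : ℝ) (W : Set (ℝ × ℝ)) : Prop where
  hA : 0 < A
  hC : 0 < C
  fin : W.Finite
  ne : W.Nonempty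
  pos : ∀ w ∈ W, 0 < w.1 ∧ w.1 < A ∧ 0 < w.2 ∧ w.2 < C
  sym : ∀ w ∈ W, ∀ x y, cel A C W w (x, y) → cel A C W w (2 * w.1 - x, 2 * w.2 - y)

theorem dsq_swap (p q : ℝ × ℝ) : dsq p.swap q.swap = dsq p q := by
  simp [dsq]; ring

theorem cel_swap {A C : ℝ} {W : Set (ℝ × ℝ)} {w q : ℝ × ℝ} :
    cel C A (Prod.swap ⁻¹' W) w.swap q.swap ↔ cel A C W w q := by
  unfold cel
  have : (∀ w' ∈ Prod.swap ⁻¹' W, dsq q.swap w.swap ≤ dsq q.swap w') ↔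
      ∀ w' ∈ W, dsq q w ≤ dsq q w' := by
    constructor
    · intro h w' hw'
      have := h w'.swap (by simpa using hw')
      rwa [dsq_swap, dsq_swap] at this
    · intro h w' hw'
      have := h w'.swap hw'
      rw [← dsq_swap, ← dsq_swap q] at this
      simpa using this
  rw [this]
  simp only [Prod.fst_swap, Prod.snd_swap]
  tauto

theorem Good.swap {A C : ℝ} {W : Set (ℝ × ℝ)} (h : Good A C W) :
    Good C A (Prod.swap ⁻¹' W) where
  hA := h.hC
  hC := h.hA
  fin := h.fin.preimage Prod.swap_injective.injOn
  ne := by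
    obtain ⟨w, hw⟩ := h.ne
    exact ⟨w.swap, by simpa using hw⟩
  pos := by
    intro w hw
    have := h.pos _ hw
    simp at this
    tauto
  sym := by
    intro w hw x y hc
    have hc' : cel C A (Prod.swap ⁻¹' W) (w.swap.swap) ((y, x) : ℝ × ℝ).swap := by
      simpa using hc
    have := h.sym _ hw y x (cel_swap.1 hc')
    have := cel_swap.2 this
    simpa using this

theorem near {A C : ℝ} {W : Set (ℝ × ℝ)} (h : Good A C W) (q : ℝ × ℝ) :
    ∃ v ∈ W, ∀ w' ∈ W, dsq q v ≤ dsq q w' :=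
  Set.exists_min_image W (dsq q) h.fin h.ne

theorem lemP {A C : ℝ} {W : Set (ℝ × ℝ)} (h : Good A C W) (x y e f : ℝ)
    (hx : 0 ≤ x ∧ x ≤ A ∧ 0 ≤ y ∧ y ≤ C)
    (hQ : ∀ᶠ t in 𝓝[>] (0 : ℝ), 0 ≤ x + t * e ∧ x + t * e ≤ A ∧ 0 ≤ y + t * f ∧ y + t * f ≤ C) :
    ∃ v ∈ W, cel A C W v (x, y) ∧ ∃ᶠ t in 𝓝[>] (0 : ℝ), cel A C W v (x + t * e, y + t * f) := by
  have key : ∃ v ∈ W, ∃ᶠ t in 𝓝[>] (0 : ℝ), cel A C W v (x + t * e, y + t * f) := by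
    by_contra hcon
    push Not at hcon
    have h1 : ∀ᶠ t in 𝓝[>] (0 : ℝ), ∀ v ∈ W, ¬ cel A C W v (x + t * e, y + t * f) := by
      rw [Filter.eventually_all_finite h.fin]
      intro v hv
      simpa [Filter.not_frequently] using hcon v hv
    obtain ⟨t, ht1, ht2⟩ := (h1.and hQ).exists
    obtain ⟨v, hv, hv2⟩ := near h (x + t * e, y + t * f)
    exact ht1 v hv ⟨ht2.1, ht2.2.1, ht2.2.2.1, ht2.2.2.2, hv2⟩
  obtain ⟨v, hv, hf⟩ := key
  refine ⟨v, hv, ⟨hx.1, hx.2.1, hx.2.2.1, hx.2.2.2, ?_⟩, hf⟩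
  intro w' hw'
  have hcl : IsClosed {t : ℝ | dsq (x + t * e, y + t * f) v ≤ dsq (x + t * e, y + t * f) w'} := by
    apply isClosed_le <;> (unfold dsq; fun_prop)
  have hfr : ∃ᶠ t in 𝓝 (0 : ℝ), t ∈ {t : ℝ | dsq (x + t * e, y + t * f) v ≤ dsq (x + t * e, y + t * f) w'} :=
    (hf.mono (fun t ht => ht.2.2.2.2 w' hw')).filter_mono nhdsWithin_le_nhds
  have := hcl.closure_eq ▸ (mem_closure_iff_frequently.2 hfr)
  simpa using this

theorem step {A C : ℝ} {W : Set (ℝ × ℝ)} (h : Good A C W) (c a b y1 y2 : ℝ) (ha : 0 < a)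
    (hc : 0 ≤ c)
    (hu : (c + a, b) ∈ W) (h1 : cel A C W (c + a, b) (c, y1)) (h2 : cel A C W (c + a, b) (c, y2))
    (hy : y1 < y2) (hl : ∀ q, cel A C W (c + a, b) q → c ≤ q.1) :
    A = c + 2 * a ∨ ((c + 3 * a, b) ∈ W ∧ (∃ z1 z2, z1 < z2 ∧
      cel A C W (c + 3 * a, b) (c + 2 * a, z1) ∧ cel A C W (c + 3 * a, b) (c + 2 * a, z2)) ∧
      ∀ q, cel A C W (c + 3 * a, b) q → c + 2 * a ≤ q.1) := by
  have e1 := h.sym _ hu _ _ h1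
  have e2 := h.sym _ hu _ _ h2
  have eqc : 2 * (c + a, b).1 - c = c + 2 * a := by simp; ring
  rw [eqc] at e1 e2
  simp only at e1 e2
  have hA : c + 2 * a ≤ A := e1.2.1
  rcases hA.eq_or_lt with hA | hA
  · left; exact hA.symm
  right
  have hr : ∀ q, cel A C W (c + a, b) q → q.1 ≤ c + 2 * a := by
    intro q hq
    have := hl _ (h.sym _ hu q.1 q.2 hq)
    simp at this
    linarith
  have hseg : ∀ y ∈ Set.Icc (2 * b - y2) (2 * b - y1), ∃ v, v ∈ W ∧ v ≠ (c + a, b) ∧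
      cel A C W v (c + 2 * a, y) ∧ cel A C W (c + a, b) (c + 2 * a, y) := by
    intro y hyy
    have hb1 : 0 ≤ y := le_trans e2.2.2.1 hyy.1
    have hb2 : y ≤ C := le_trans hyy.2 e1.2.2.2.1
    obtain ⟨v, hv, hv1, hv2⟩ := lemP h (c + 2 * a) y 1 0 ⟨by linarith, hA.le, hb1, hb2⟩ (by
      have : ∀ᶠ t in 𝓝[>] (0 : ℝ), t < A - (c + 2 * a) :=
        nhdsWithin_le_nhds (Iio_mem_nhds (by linarith))
      filter_upwards [this, self_mem_nhdsWithin] with t ht ht0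
      simp at ht0
      refine ⟨by linarith, by linarith, by linarith, by linarith⟩)
    refine ⟨v, hv, ?_, hv1, ⟨by simp; linarith, hA.le, hb1, hb2, ?_⟩⟩
    · rintro rfl
      obtain ⟨t, ht, ht0⟩ := (hv2.and_eventually self_mem_nhdsWithin).exists
      have := hr _ ht
      have ht0 : 0 < t := ht0
      simp at this
      linarith
    · intro w' hw'
      have i1 := e1.2.2.2.2 w' hw'
      have i2 := e2.2.2.2.2 w' hw'
      simp only [dsq] at i1 i2 ⊢
      have j1 : (0:ℝ) ≤ y - (2 * b - y2) := by linarith [hyy.1]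
      have j2 : (0:ℝ) ≤ (2 * b - y1) - y := by linarith [hyy.2]
      have k1 := mul_le_mul_of_nonneg_left i1 j1
      have k2 := mul_le_mul_of_nonneg_left i2 j2
      have : 0 < y2 - y1 := by linarith
      refine le_of_mul_le_mul_left ?_ this
      nlinarith [k1, k2]
  choose! g hg using hseg
  obtain ⟨y, hy1, z, hz1, hyz, hgyz⟩ := (Set.Icc_infinite (show 2 * b - y2 < 2 * b - y1 by linarith)).exists_ne_map_eq_of_mapsTo (f := g)
    (t := W) (fun y hy => (hg y hy).1) h.fin
  obtain ⟨a1, a2, a3, a4⟩ := hg y hy1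
  obtain ⟨b1, b2, b3, b4⟩ := hg z hz1
  rw [← hgyz] at b1 b2 b3
  have hv : g y = (c + 3 * a, b) := by
    have d1 := le_antisymm (a3.2.2.2.2 _ hu) (a4.2.2.2.2 _ a1)
    have d2 := le_antisymm (b3.2.2.2.2 _ hu) (b4.2.2.2.2 _ a1)
    obtain ⟨⟨p, r⟩, hgv⟩ : ∃ x, g y = x := ⟨_, rfl⟩
    rw [hgv] at d1 d2 a2
    simp only [dsq] at d1 d2
    have hrb : r = b := by
      have : (y - z) * (r - b) = 0 := by nlinarith
      rcases mul_eq_zero.1 this with h | h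
      · exact absurd (by linarith) hyz
      · linarith
    subst hrb
    have : (p - (c + a)) * (p - (c + 3 * a)) = 0 := by nlinarith
    rcases mul_eq_zero.1 this with h | h
    · exact absurd (by rw [show p = c + a by linarith]) a2
    · rw [hgv, show p = c + 3 * a by linarith]
  rw [hv] at a1 a3 b3
  refine ⟨a1, ?_, ?_⟩
  · rcases lt_or_gt_of_ne hyz with hlt | hlt
    · exact ⟨y, z, hlt, a3, b3⟩
    · exact ⟨z, y, hlt, b3, a3⟩
  · intro q hq
    have := hq.2.2.2.2 _ hu
    simp only [dsq] at this
    by_contra hcon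
    push Not at hcon
    nlinarith

theorem row {A C : ℝ} {W : Set (ℝ × ℝ)} (h : Good A C W) (v : ℝ × ℝ) (hv : v ∈ W) (y1 y2 : ℝ)
    (h1 : cel A C W v (0, y1)) (h2 : cel A C W v (0, y2)) (hy : y1 < y2) :
    ∃ k : ℕ, A = 2 * k * v.1 ∧ ∀ j : ℕ, j < k → ((2 * j + 1) * v.1, v.2) ∈ W := by
  by_contra hcon
  push Not at hcon
  have ha := (h.pos v hv).1
  have key : ∀ j : ℕ, (∀ i ≤ j, ((2 * (i : ℝ) + 1) * v.1, v.2) ∈ W) ∧ (∃ z1 z2, z1 < z2 ∧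
      cel A C W (2 * j * v.1 + v.1, v.2) (2 * j * v.1, z1) ∧
      cel A C W (2 * j * v.1 + v.1, v.2) (2 * j * v.1, z2)) ∧
      ∀ q, cel A C W (2 * j * v.1 + v.1, v.2) q → 2 * j * v.1 ≤ q.1 := by
    intro j
    induction j with
    | zero =>
      refine ⟨?_, ⟨y1, y2, hy, ?_, ?_⟩, ?_⟩
      · intro i hi
        obtain rfl : i = 0 := by omega
        simpa using hv
      · simpa using h1
      · simpa using h2
      · intro q hq
        simpa using hq.1
    | succ j ih =>
      obtain ⟨i1, ⟨z1, z2, hz, i2, i3⟩, i4⟩ := ih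
      have hm : (2 * j * v.1 + v.1, v.2) ∈ W := by
        have := i1 j le_rfl
        rwa [show (2 * (j:ℝ) + 1) * v.1 = 2 * j * v.1 + v.1 by ring] at this
      rcases step h _ v.1 v.2 z1 z2 ha (by positivity) hm i2 i3 hz i4 with hs | ⟨s1, s2, s3⟩
      · exfalso
        obtain ⟨j', hj', hj2⟩ := hcon (j + 1) (by push_cast; linarith)
        exact hj2 (i1 j' (by omega))
      · have e1 : 2 * (j:ℝ) * v.1 + 3 * v.1 = 2 * ((j + 1 : ℕ) : ℝ) * v.1 + v.1 := by
          push_cast; ring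
        have e2 : 2 * (j:ℝ) * v.1 + 2 * v.1 = 2 * ((j + 1 : ℕ) : ℝ) * v.1 := by
          push_cast; ring
        rw [e1] at s1 s2 s3
        rw [e2] at s2 s3
        refine ⟨?_, s2, s3⟩
        intro i hi
        rcases Nat.lt_or_ge i (j + 1) with hlt | hge
        · exact i1 i (by omega)
        · obtain rfl : i = j + 1 := by omega
          rwa [show 2 * ((j + 1 : ℕ) : ℝ) * v.1 + v.1 = (2 * ((j + 1 : ℕ) : ℝ) + 1) * v.1 by ring] at s1
  obtain ⟨N, hN⟩ := exists_nat_gt (A / v.1)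
  have := h.pos _ ((key N).1 N le_rfl)
  rw [div_lt_iff₀ ha] at hN
  simp only at this
  have hN0 : (0 : ℝ) ≤ N := by positivity
  nlinarith [this.2.1]

theorem leftIneq {A C : ℝ} {W : Set (ℝ × ℝ)} (h : Good A C W) (x y : ℝ)
    (hx : 0 ≤ x ∧ x ≤ A ∧ 0 ≤ y ∧ y ≤ C) (w : ℝ × ℝ) (hw : w ∈ W) :
    ∃ w' ∈ W, dsq (x, y) w' ≤ dsq (0, y) w := by
  obtain ⟨hx0, hxA, hy0, hyC⟩ := hx
  have hA := h.hA
  have hC := h.hC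
  have : ∃ v ∈ W, cel A C W v (0, y) ∧ ∃ y1 y2, y1 < y2 ∧ cel A C W v (0, y1) ∧ cel A C W v (0, y2) := by
    rcases hyC.eq_or_lt with hy | hy
    · obtain ⟨v, hv, hv1, hv2⟩ := lemP h 0 y 0 (-1) ⟨le_rfl, hA.le, hy0, hyC⟩ (by
        have : ∀ᶠ t in 𝓝[>] (0 : ℝ), t < C :=
          nhdsWithin_le_nhds (Iio_mem_nhds (by linarith))
        filter_upwards [this, self_mem_nhdsWithin] with t ht ht0
        simp at ht0
        refine ⟨by linarith, by linarith, by linarith, by linarith⟩)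
      obtain ⟨t, ht, ht0⟩ := (hv2.and_eventually self_mem_nhdsWithin).exists
      have ht0 : 0 < t := ht0
      exact ⟨v, hv, hv1, y + t * (-1), y, by linarith, by simpa using ht, hv1⟩
    · obtain ⟨v, hv, hv1, hv2⟩ := lemP h 0 y 0 1 ⟨le_rfl, hA.le, hy0, hyC⟩ (by
        have : ∀ᶠ t in 𝓝[>] (0 : ℝ), t < C - y :=
          nhdsWithin_le_nhds (Iio_mem_nhds (by linarith))
        filter_upwards [this, self_mem_nhdsWithin] with t ht ht0
        simp at ht0
        refine ⟨by linarith, by linarith, by linarith, by linarith⟩)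
      obtain ⟨t, ht, ht0⟩ := (hv2.and_eventually self_mem_nhdsWithin).exists
      have ht0 : 0 < t := ht0
      exact ⟨v, hv, hv1, y, y + t * 1, by linarith, hv1, by simpa using ht⟩
  obtain ⟨v, hv, hv1, y1, y2, hy12, c1, c2⟩ := this
  obtain ⟨k, hk, hrow⟩ := row h v hv y1 y2 c1 c2 hy12
  have ha := (h.pos v hv).1
  have hkpos : 0 < k := by
    rcases Nat.eq_zero_or_pos k with h0 | h0
    · subst h0; simp at hk; linarith
    · exact h0
  have hj : ∃ j : ℕ, j < k ∧ 2 * j * v.1 ≤ x ∧ x ≤ 2 * (j + 1) * v.1 := by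
    by_cases hxk : x = A
    · refine ⟨k - 1, by omega, ?_, ?_⟩
      · rw [Nat.cast_sub hkpos]; push_cast; nlinarith
      · rw [Nat.cast_sub hkpos]; push_cast; nlinarith
    · have hlt : x < A := lt_of_le_of_ne hxA hxk
      have f1 := Nat.floor_le (show 0 ≤ x / (2 * v.1) by positivity)
      have f2 := Nat.lt_floor_add_one (x / (2 * v.1))
      rw [le_div_iff₀ (by positivity)] at f1
      rw [div_lt_iff₀ (by positivity)] at f2
      refine ⟨⌊x / (2 * v.1)⌋₊, ?_, by linarith, by linarith⟩
      rw [Nat.floor_lt (by positivity), div_lt_iff₀ (by positivity)]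
      linarith
  obtain ⟨j, hjk, hj1, hj2⟩ := hj
  refine ⟨_, hrow j hjk, le_trans ?_ (hv1.2.2.2.2 w hw)⟩
  simp only [dsq]
  nlinarith

theorem botIneq {A C : ℝ} {W : Set (ℝ × ℝ)} (h : Good A C W) (x y : ℝ)
    (hx : 0 ≤ x ∧ x ≤ A ∧ 0 ≤ y ∧ y ≤ C) (w : ℝ × ℝ) (hw : w ∈ W) :
    ∃ w' ∈ W, dsq (x, y) w' ≤ dsq (x, 0) w := by
  obtain ⟨w', hw', hd⟩ := leftIneq h.swap y x (by tauto) w.swap (by simpa using hw)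
  refine ⟨w'.swap, hw', ?_⟩
  rw [← dsq_swap, ← dsq_swap (x, 0)]
  simpa using hd

theorem col {A C : ℝ} {W : Set (ℝ × ℝ)} (h : Good A C W) (v : ℝ × ℝ) (hv : v ∈ W) (y1 y2 : ℝ)
    (h1 : cel A C W v (y1, 0)) (h2 : cel A C W v (y2, 0)) (hy : y1 < y2) :
    ∃ k : ℕ, C = 2 * k * v.2 ∧ ∀ j : ℕ, j < k → (v.1, (2 * j + 1) * v.2) ∈ W := by
  have := row h.swap v.swap (by simpa using hv) y1 y2 (cel_swap.2 h1) (cel_swap.2 h2) hy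
  simpa using this

theorem grid {A C : ℝ} {W : Set (ℝ × ℝ)} (h : Good A C W) :
    ∃ (k m : ℕ) (a b : ℝ), 0 < a ∧ 0 < b ∧ A = 2 * k * a ∧ C = 2 * m * b ∧
      ∀ p, p ∈ W ↔ ∃ i < k, ∃ j < m, p = ((2 * (i : ℝ) + 1) * a, (2 * (j : ℝ) + 1) * b) := by
  obtain ⟨w, hw, hmin⟩ := near h (0, 0)
  obtain ⟨a, b⟩ := w
  have hA := h.hA
  have hC := h.hC
  obtain ⟨ha, haA, hb, hbC⟩ := h.pos _ hw
  simp only at ha haA hb hbC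
  have hD : ∀ w' ∈ W, a ^ 2 + b ^ 2 ≤ dsq (0, 0) w' := by
    intro w' hw'
    have := hmin w' hw'
    simpa [dsq] using this
  -- far points
  let far : ℝ → ℝ → Prop := fun x y =>
    0 ≤ x ∧ x ≤ A ∧ 0 ≤ y ∧ y ≤ C ∧ ∀ w' ∈ W, a ^ 2 + b ^ 2 ≤ dsq (x, y) w'
  have c0 : cel A C W (a, b) (0, 0) := ⟨le_rfl, hA.le, le_rfl, hC.le, hmin⟩
  have c1 := h.sym _ hw _ _ c0
  simp only [sub_zero] at c1
  have far1 : far (2 * a) (2 * b) := by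
    refine ⟨c1.1, c1.2.1, c1.2.2.1, c1.2.2.2.1, fun w' hw' => ?_⟩
    have := c1.2.2.2.2 w' hw'
    refine le_trans (le_of_eq ?_) this
    simp only [dsq]; ring
  have far0 : far 0 0 := ⟨le_rfl, hA.le, le_rfl, hC.le, hD⟩
  have far2 : far (2 * a) 0 := by
    refine ⟨c1.1, c1.2.1, le_rfl, hC.le, fun w' hw' => ?_⟩
    obtain ⟨w2, hw2, hd⟩ := botIneq h (2 * a) (2 * b) ⟨c1.1, c1.2.1, c1.2.2.1, c1.2.2.2.1⟩ w' hw'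
    exact le_trans (far1.2.2.2.2 w2 hw2) hd
  have far3 : far 0 (2 * b) := by
    refine ⟨le_rfl, hA.le, c1.2.2.1, c1.2.2.2.1, fun w' hw' => ?_⟩
    obtain ⟨w2, hw2, hd⟩ := leftIneq h (2 * a) (2 * b) ⟨c1.1, c1.2.1, c1.2.2.1, c1.2.2.2.1⟩ w' hw'
    exact le_trans (far1.2.2.2.2 w2 hw2) hd
  have farcel : ∀ x y u v, far x y → (x - u) ^ 2 = a ^ 2 → (y - v) ^ 2 = b ^ 2 →
      cel A C W (u, v) (x, y) := by
    intro x y u v hf h1 h2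
    refine ⟨hf.1, hf.2.1, hf.2.2.1, hf.2.2.2.1, fun w' hw' => ?_⟩
    refine le_trans (le_of_eq ?_) (hf.2.2.2.2 w' hw')
    simp only [dsq, h1, h2]
  have farsym : ∀ x y u v, (u, v) ∈ W → far x y → (x - u) ^ 2 = a ^ 2 → (y - v) ^ 2 = b ^ 2 →
      far (2 * u - x) (2 * v - y) := by
    intro x y u v hm hf h1 h2
    have := h.sym _ hm _ _ (farcel x y u v hf h1 h2)
    refine ⟨this.1, this.2.1, this.2.2.1, this.2.2.2.1, fun w' hw' => ?_⟩
    refine le_trans (le_of_eq ?_) (this.2.2.2.2 w' hw')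
    simp only [dsq]
    nlinarith
  obtain ⟨k, hk, hrow⟩ := row h (a, b) hw 0 (2 * b) c0 (farcel _ _ _ _ far3 (by ring) (by ring)) (by linarith)
  simp only at hk hrow
  obtain ⟨m, hm, -⟩ := col h (a, b) hw 0 (2 * a) c0 (farcel _ _ _ _ far2 (by ring) (by ring)) (by linarith)
  simp only at hm
  have frow : ∀ i : ℕ, i ≤ k → far (2 * i * a) 0 ∧ far (2 * i * a) (2 * b) := by
    intro i
    induction i with
    | zero => intro _; simpa using ⟨far0, far3⟩
    | succ i ih =>
      intro hi
      obtain ⟨f1, f2⟩ := ih (by omega)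
      have hs := hrow i (by omega)
      have g1 := farsym _ _ _ _ hs f1 (by ring) (by ring)
      have g2 := farsym _ _ _ _ hs f2 (by ring) (by ring)
      rw [show 2 * ((2 * (i:ℝ) + 1) * a) - 2 * i * a = 2 * ((i + 1 : ℕ) : ℝ) * a by push_cast; ring] at g1 g2
      rw [show 2 * b - 0 = 2 * b by ring] at g1
      rw [show 2 * b - 2 * b = 0 by ring] at g2
      exact ⟨g2, g1⟩
  have hall : ∀ i < k, ∀ j < m, ((2 * (i : ℝ) + 1) * a, (2 * (j : ℝ) + 1) * b) ∈ W := by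
    intro i hi j hj
    have f1 := (frow i hi.le).1
    have f2 := (frow (i + 1) hi).1
    obtain ⟨m', hm', hc⟩ := col h _ (hrow i hi) _ _ (farcel _ _ _ _ f1 (by ring) (by ring))
      (farcel _ _ _ _ f2 (by push_cast; ring) (by ring)) (by push_cast; nlinarith)
    simp only at hm' hc
    have : (m : ℝ) = m' := by
      have : (m : ℝ) * (2 * b) = m' * (2 * b) := by linarith
      exact mul_right_cancel₀ (by positivity) this
    have : m = m' := by exact_mod_cast this
    subst this
    exact hc j hj
  have fall : ∀ j : ℕ, j ≤ m → ∀ i < k, far (2 * i * a) (2 * j * b) ∧ far (2 * (i + 1) * a) (2 * j * b) := by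
    intro j
    induction j with
    | zero =>
      intro _ i hi
      have := frow (i + 1) hi
      push_cast at this
      simpa using ⟨(frow i hi.le).1, this.1⟩
    | succ j ih =>
      intro hj i hi
      obtain ⟨f1, f2⟩ := ih (by omega) i hi
      have hs := hall i hi j (by omega)
      have g1 := farsym _ _ _ _ hs f1 (by ring) (by ring)
      have g2 := farsym _ _ _ _ hs f2 (by ring) (by ring)
      rw [show 2 * ((2 * (i:ℝ) + 1) * a) - 2 * i * a = 2 * (i + 1) * a by ring,
        show 2 * ((2 * (j:ℝ) + 1) * b) - 2 * j * b = 2 * ((j + 1 : ℕ) : ℝ) * b by push_cast; ring] at g1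
      rw [show 2 * ((2 * (i:ℝ) + 1) * a) - 2 * (i + 1) * a = 2 * i * a by ring,
        show 2 * ((2 * (j:ℝ) + 1) * b) - 2 * j * b = 2 * ((j + 1 : ℕ) : ℝ) * b by push_cast; ring] at g2
      exact ⟨g2, g1⟩
  refine ⟨k, m, a, b, ha, hb, hk, hm, fun p => ⟨fun hp => ?_, ?_⟩⟩
  · obtain ⟨x, y⟩ := p
    obtain ⟨hx0, hxA, hy0, hyC⟩ := h.pos _ hp
    simp only at hx0 hxA hy0 hyC
    have fl : ∀ (x A a : ℝ) (k : ℕ), 0 < x → x < A → 0 < a → A = 2 * k * a →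
        ∃ j < k, 2 * j * a ≤ x ∧ x ≤ 2 * (j + 1) * a := by
      intro x A a k hx0 hlt ha hk
      have f1 := Nat.floor_le (show 0 ≤ x / (2 * a) by positivity)
      have f2 := Nat.lt_floor_add_one (x / (2 * a))
      rw [le_div_iff₀ (by positivity)] at f1
      rw [div_lt_iff₀ (by positivity)] at f2
      refine ⟨⌊x / (2 * a)⌋₊, ?_, by linarith, by linarith⟩
      rw [Nat.floor_lt (by positivity), div_lt_iff₀ (by positivity)]
      linarith
    obtain ⟨i, hi, hi1, hi2⟩ := fl x A a k hx0 hxA ha hk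
    obtain ⟨j, hj, hj1, hj2⟩ := fl y C b m hy0 hyC hb hm
    refine ⟨i, hi, j, hj, ?_⟩
    have q1 := (fall j hj.le i hi).1.2.2.2.2 _ hp
    have q2 := (fall j hj.le i hi).2.2.2.2.2 _ hp
    have q3 := (fall (j + 1) hj i hi).1.2.2.2.2 _ hp
    have q4 := (fall (j + 1) hj i hi).2.2.2.2.2 _ hp
    simp only [dsq] at q1 q2 q3 q4
    push_cast at q1 q2 q3 q4
    obtain ⟨s, hs⟩ : ∃ s, s = x - (2 * i + 1) * a := ⟨_, rfl⟩
    obtain ⟨t, ht⟩ : ∃ t, t = y - (2 * j + 1) * b := ⟨_, rfl⟩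
    obtain rfl : x = (2 * i + 1) * a + s := by linarith
    obtain rfl : y = (2 * j + 1) * b + t := by linarith
    have s1 : -a ≤ s := by linarith
    have s2 : s ≤ a := by linarith
    have t1 : -b ≤ t := by linarith
    have t2 : t ≤ b := by linarith
    have r1 : 2 * -(s * a) + 2 * -(t * b) ≤ s ^ 2 + t ^ 2 := by linarith
    have r2 : 2 * (s * a) + 2 * -(t * b) ≤ s ^ 2 + t ^ 2 := by linarith
    have r3 : 2 * -(s * a) + 2 * (t * b) ≤ s ^ 2 + t ^ 2 := by linarith
    have r4 : 2 * (s * a) + 2 * (t * b) ≤ s ^ 2 + t ^ 2 := by linarith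
    have hs' : s ^ 2 ≤ |s| * a := by
      rw [← sq_abs, sq]; exact mul_le_mul_of_nonneg_left (abs_le.2 ⟨s1, s2⟩) (abs_nonneg _)
    have ht' : t ^ 2 ≤ |t| * b := by
      rw [← sq_abs, sq]; exact mul_le_mul_of_nonneg_left (abs_le.2 ⟨t1, t2⟩) (abs_nonneg _)
    have r : 2 * (|s| * a) + 2 * (|t| * b) ≤ s ^ 2 + t ^ 2 := by
      rcases abs_cases s with ⟨e, _⟩ | ⟨e, _⟩ <;> rcases abs_cases t with ⟨e', _⟩ | ⟨e', _⟩ <;>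
        rw [e, e'] <;> linarith
    have p1 : 0 ≤ |s| * a := by positivity
    have p2 : 0 ≤ |t| * b := by positivity
    have z1 : s ^ 2 = 0 := by nlinarith [sq_nonneg s, sq_nonneg t]
    have z2 : t ^ 2 = 0 := by nlinarith [sq_nonneg s, sq_nonneg t]
    rw [pow_eq_zero_iff (by norm_num)] at z1 z2
    rw [z1, z2, add_zero, add_zero]
  · rintro ⟨i, hi, j, hj, rfl⟩
    exact hall i hi j hj
end VG

namespace VM
open Filter Topology

abbrev E := EuclideanSpace ℝ (Fin 2)

theorem inner2 (x y : E) : inner ℝ x y = x 0 * y 0 + x 1 * y 1 := by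
  simp [PiLp.inner_apply, Fin.sum_univ_two]; ring

theorem vol_board {ρ : ℝ} (h : 0 < ρ) : volume (board ρ) = ENNReal.ofReal ρ := by
  have e : board ρ = (WithLp.ofLp : E → (Fin 2 → ℝ)) ⁻¹' (Set.Icc ![0, 0] ![1, ρ]) := by
    ext q
    simp [board, Set.mem_Icc, Pi.le_def, Fin.forall_fin_two]
    tauto
  have hp := EuclideanSpace.volume_preserving_symm_measurableEquiv_toLp (Fin 2)
  have := hp.measure_preimage (s := Set.Icc ![0, 0] ![1, ρ]) measurableSet_Icc.nullMeasurableSet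
  rw [e]
  refine Eq.trans this ?_
  rw [Real.volume_Icc_pi]
  simp [Fin.prod_univ_two]

theorem closed_board (ρ : ℝ) : IsClosed (board ρ) := by
  have : board ρ = (fun q : E => q 0) ⁻¹' Set.Icc 0 1 ∩ (fun q : E => q 1) ⁻¹' Set.Icc 0 ρ := rfl
  rw [this]
  exact (isClosed_Icc.preimage (by fun_prop)).inter (isClosed_Icc.preimage (by fun_prop))

theorem null_bis {w w' : E} (h : w ≠ w') : volume {q : E | dist q w = dist q w'} = 0 := by
  have : {q : E | dist q w = dist q w'} = (AffineSubspace.perpBisector w w' : Set E) := by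
    ext q; simp [AffineSubspace.mem_perpBisector_iff_dist_eq]
  rw [this]
  apply Measure.addHaar_affineSubspace
  simpa using h

theorem lt_iff (w w' y : E) : dist (w + y) w < dist (w + y) w' ↔
    2 * inner ℝ y (w' - w) < ‖w' - w‖ ^ 2 := by
  have e1 : dist (w + y) w = ‖y‖ := by simp [dist_eq_norm]
  have e2 : dist (w + y) w' = ‖y - (w' - w)‖ := by rw [dist_eq_norm]; congr 1; abel
  rw [e1, e2, ← sq_lt_sq₀ (norm_nonneg _) (norm_nonneg _), norm_sub_sq_real]
  constructor <;> intro h <;> linarith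

theorem le_iff (w w' y : E) : dist (w + y) w ≤ dist (w + y) w' ↔
    2 * inner ℝ y (w' - w) ≤ ‖w' - w‖ ^ 2 := by
  have e1 : dist (w + y) w = ‖y‖ := by simp [dist_eq_norm]
  have e2 : dist (w + y) w' = ‖y - (w' - w)‖ := by rw [dist_eq_norm]; congr 1; abel
  rw [e1, e2, ← sq_le_sq₀ (norm_nonneg _) (norm_nonneg _), norm_sub_sq_real]
  constructor <;> intro h <;> linarith

theorem null_line (w : E) {u : E} (h : u ≠ 0) : volume {q : E | inner ℝ (q - w) u = 0} = 0 := by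
  have hne : w + u ≠ w - u := by
    intro h'
    apply h
    have : (2 : ℝ) • u = 0 := by
      rw [two_smul]
      calc u + u = (w + u) - (w - u) := by abel
        _ = 0 := by rw [h']; simp
    simpa using this
  rw [← null_bis hne]
  congr 1
  ext q
  simp only [mem_ofPred_eq]
  have e1 : dist q (w + u) = ‖(q - w) - u‖ := by rw [dist_eq_norm]; congr 1; abel
  have e2 : dist q (w - u) = ‖(q - w) + u‖ := by rw [dist_eq_norm]; congr 1; abel
  rw [e1, e2, ← sq_eq_sq₀ (norm_nonneg _) (norm_nonneg _), norm_sub_sq_real, norm_add_sq_real]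
  constructor <;> intro h <;> linarith

def O (ρ : ℝ) (W : Set E) (w : E) : Set E :=
  {q | q ∈ board ρ ∧ ∀ w' ∈ W, w' ≠ w → dist q w < dist q w'}

def H (w u : E) : Set E := {q | 0 < inner ℝ (q - w) u}

theorem meas_O (ρ : ℝ) {W : Set E} (hW : W.Finite) (w : E) : MeasurableSet (O ρ W w) := by
  have : O ρ W w = board ρ ∩ ⋂ w' ∈ W, {q | w' ≠ w → dist q w < dist q w'} := by
    ext q; simp [O]
  rw [this]
  refine (closed_board ρ).measurableSet.inter (hW.measurableSet_biInter fun w' _ => ?_)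
  by_cases h : w' = w
  · simp [h]
  · simp only [ne_eq, h, not_false_eq_true, forall_const]
    exact (isOpen_lt (by fun_prop) (by fun_prop)).measurableSet

theorem open_H (w u : E) : IsOpen (H w u) :=
  isOpen_lt (by fun_prop) (by fun_prop)

theorem vol_lt {ρ : ℝ} (hρ : 0 < ρ) {S : Set E} (h : S ⊆ board ρ) : volume S ≠ ⊤ := by
  refine ne_top_of_le_ne_top ?_ (measure_mono h)
  rw [vol_board hρ]; exact ENNReal.ofReal_ne_top

theorem O_sub {ρ : ℝ} {W : Set E} {w : E} : O ρ W w ⊆ board ρ := fun _ h => h.1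

theorem split {ρ : ℝ} (hρ : 0 < ρ) {S : Set E} (h : S ⊆ board ρ) (w : E) {u : E} (hu : u ≠ 0) :
    volume.real S = volume.real (S ∩ H w u) + volume.real (S ∩ H w (-u)) := by
  have h1 := measure_inter_add_sdiff (μ := volume) S (open_H w u).measurableSet
  have h2 : volume (S \ H w u) = volume (S ∩ H w (-u)) := by
    apply le_antisymm
    · have : S \ H w u ⊆ (S ∩ H w (-u)) ∪ {q : E | inner ℝ (q - w) u = 0} := by
        rintro q ⟨hq, hn⟩
        simp only [H, mem_ofPred_eq, not_lt] at hn
        rcases hn.eq_or_lt with h | h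
        · right; exact h
        · left; exact ⟨hq, by simp only [H, mem_ofPred_eq, inner_neg_right]; linarith⟩
      refine (measure_mono this).trans ((measure_union_le _ _).trans ?_)
      rw [null_line w hu, add_zero]
    · apply measure_mono
      rintro q ⟨hq, hn⟩
      refine ⟨hq, fun hh => ?_⟩
      simp only [H, mem_ofPred_eq, inner_neg_right] at hn hh
      linarith
  rw [h2] at h1
  simp only [measureReal_def]
  rw [← h1, ENNReal.toReal_add]
  · exact vol_lt hρ (inter_subset_left.trans h)
  · exact vol_lt hρ (inter_subset_left.trans h)

theorem total {ρ : ℝ} (hρ : 0 < ρ) (W : Finset E) (hne : W.Nonempty) :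
    ρ ≤ ∑ w ∈ W, volume.real (O ρ W w) := by
  have h1 : board ρ ⊆ (⋃ w ∈ W, O ρ W w) ∪
      ⋃ w ∈ W, ⋃ w' ∈ W, {q | w ≠ w' ∧ dist q w = dist q w'} := by
    intro q hq
    obtain ⟨w, hw, hm⟩ := W.exists_min_image (fun w => dist q w) hne
    by_cases h : ∃ w' ∈ W, w ≠ w' ∧ dist q w = dist q w'
    · right
      obtain ⟨w', hw', h⟩ := h
      simp only [mem_iUnion]
      exact ⟨w, hw, w', hw', h⟩
    · left
      push Not at h
      simp only [mem_iUnion]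
      refine ⟨w, hw, hq, fun w' hw' hn => lt_of_le_of_ne (hm w' hw') (h w' hw' hn.symm)⟩
  have h2 : volume (⋃ w ∈ W, ⋃ w' ∈ W, {q : E | w ≠ w' ∧ dist q w = dist q w'}) = 0 := by
    refine (measure_biUnion_null_iff W.countable_toSet).2 ?_
    intro w _
    refine (measure_biUnion_null_iff W.countable_toSet).2 ?_
    intro w' _
    by_cases h : w = w'
    · simp [h]
    · simpa [h] using null_bis h
  have h3 : ENNReal.ofReal ρ ≤ ∑ w ∈ W, volume (O ρ W w) := by
    rw [← vol_board hρ]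
    refine (measure_mono h1).trans ((measure_union_le _ _).trans ?_)
    rw [h2, add_zero]
    exact measure_biUnion_finset_le _ _
  simp only [measureReal_def]
  rw [← ENNReal.toReal_sum (fun w _ => vol_lt hρ O_sub)]
  rw [← ENNReal.ofReal_le_iff_le_toReal]
  · exact h3
  · exact (ENNReal.sum_lt_top.2 fun w _ => (vol_lt hρ O_sub).lt_top).ne

theorem O_disj {ρ : ℝ} {W : Set E} {w w' : E} (hw : w ∈ W) (hw' : w' ∈ W) (h : w ≠ w') :
    Disjoint (O ρ W w) (O ρ W w') := by
  rw [Set.disjoint_left]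
  intro q h1 h2
  have := h1.2 w' hw' h.symm
  have := h2.2 w hw h
  linarith

def NoWin (ρ : ℝ) (W : Finset E) : Prop :=
  ∀ B : Set E, B ⊆ board ρ → B.Finite → B.ncard = W.card →
      volume {q | q ∈ board ρ ∧ infDist q B < infDist q W} ≤ ENNReal.ofReal (ρ / 2)

def feas (ρ : ℝ) (w u : E) : Prop := ∀ᶠ ε in 𝓝[>] (0 : ℝ), w + ε • u ∈ board ρ

theorem half {ρ : ℝ} (hρ : 0 < ρ) (W : Finset E) (hnw : NoWin ρ W)
    (u : E → E) (hu : ∀ w ∈ W, feas ρ w (u w)) :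
    ∑ w ∈ W, volume.real (O ρ W w ∩ H w (u w)) ≤ ρ / 2 := by
  classical
  let G : ℝ → E → Set E := fun ε w => O ρ W w ∩ {q | ε * ‖u w‖ ^ 2 / 2 < inner ℝ (q - w) (u w)}
  have hinj : ∀ᶠ ε in 𝓝[>] (0 : ℝ), ∀ w ∈ W, ∀ w' ∈ W, w ≠ w' → w + ε • u w ≠ w' + ε • u w' := by
    rw [Filter.eventually_all_finset]
    intro w _
    rw [Filter.eventually_all_finset]
    intro w' _
    by_cases h : w = w'
    · simp [h]
    · have : ∀ᶠ ε in 𝓝 (0 : ℝ), w + ε • u w ≠ w' + ε • u w' := by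
        have ho : IsOpen {ε : ℝ | w + ε • u w ≠ w' + ε • u w'} :=
          isOpen_ne_fun (by fun_prop) (by fun_prop)
        exact ho.mem_nhds (by simpa using h)
      filter_upwards [nhdsWithin_le_nhds this] with ε hε _ using hε
  have hfe : ∀ᶠ ε in 𝓝[>] (0 : ℝ), ∀ w ∈ W, w + ε • u w ∈ board ρ := by
    rw [Filter.eventually_all_finset]
    exact hu
  have hev : ∀ᶠ ε in 𝓝[>] (0 : ℝ), ∑ w ∈ W, volume (G ε w) ≤ ENNReal.ofReal (ρ / 2) := by
    filter_upwards [hinj, hfe, self_mem_nhdsWithin] with ε h1 h2 h3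
    have h3 : 0 < ε := h3
    let f : E → E := fun w => w + ε • u w
    have hB := hnw (f '' W) (by
      rintro _ ⟨w, hw, rfl⟩; exact h2 w hw) (W.finite_toSet.image f) (by
      rw [Set.InjOn.ncard_image, Set.ncard_coe_finset]
      intro a ha b hb hab
      by_contra hne
      exact h1 a ha b hb hne hab)
    refine le_trans ?_ hB
    rw [← measure_biUnion_finset]
    · apply measure_mono
      intro q hq
      simp only [mem_iUnion] at hq
      obtain ⟨w, hw, hq1, hq2⟩ := hq
      refine ⟨hq1.1, ?_⟩
      calc infDist q (f '' W) ≤ dist q (f w) := infDist_le_dist_of_mem ⟨w, hw, rfl⟩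
        _ < dist q w := by
          have := lt_iff (w + ε • u w) w (q - (w + ε • u w))
          rw [add_sub_cancel] at this
          rw [this]
          simp only [mem_ofPred_eq] at hq2
          have e1 : w - (w + ε • u w) = - (ε • u w) := by abel
          have e2 : q - (w + ε • u w) = (q - w) - ε • u w := by abel
          rw [e1, e2, inner_neg_right, inner_sub_left, norm_neg, real_inner_smul_right,
            real_inner_self_eq_norm_sq, norm_smul, Real.norm_of_nonneg h3.le]
          nlinarith
        _ ≤ infDist q W := by
          rw [le_infDist ⟨w, hw⟩]
          intro y hy
          by_cases hyw : y = w
          · rw [hyw]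
          · exact (hq1.2 y hy hyw).le
    · intro w hw w' hw' hne
      exact (O_disj hw hw' hne).mono inter_subset_left inter_subset_left
    · intro w _
      exact (meas_O ρ W.finite_toSet w).inter (isOpen_lt (by fun_prop) (by fun_prop)).measurableSet
  have hseq : Tendsto (fun n : ℕ => 1 / ((n : ℝ) + 1)) atTop (𝓝[>] 0) := by
    rw [tendsto_nhdsWithin_iff]
    exact ⟨tendsto_one_div_add_atTop_nhds_zero_nat, Eventually.of_forall fun n => by
      simp only [mem_Ioi]; positivity⟩
  have hev2 := hseq.eventually hev
  have hlim : ∀ w, Tendsto (fun n : ℕ => volume (G (1 / ((n : ℝ) + 1)) w)) atTop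
      (𝓝 (volume (O ρ W w ∩ H w (u w)))) := by
    intro w
    have hU : O ρ W w ∩ H w (u w) = ⋃ n : ℕ, G (1 / ((n : ℝ) + 1)) w := by
      ext q
      simp only [mem_iUnion]
      constructor
      · rintro ⟨h1, h2⟩
        simp only [H, mem_ofPred_eq] at h2
        have : Tendsto (fun n : ℕ => 1 / ((n : ℝ) + 1) * ‖u w‖ ^ 2 / 2) atTop (𝓝 (0 * ‖u w‖ ^ 2 / 2)) :=
          (tendsto_one_div_add_atTop_nhds_zero_nat.mul_const _).div_const _
        rw [zero_mul, zero_div] at this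
        obtain ⟨n, hn⟩ := (this.eventually (gt_mem_nhds h2)).exists
        exact ⟨n, h1, hn⟩
      · rintro ⟨n, h1, h2⟩
        refine ⟨h1, ?_⟩
        simp only [H, mem_ofPred_eq] at h2 ⊢
        refine lt_of_le_of_lt ?_ h2
        positivity
    rw [hU]
    apply tendsto_measure_iUnion_atTop
    intro a b hab q hq
    have hq2 := hq.2
    simp only [mem_ofPred_eq] at hq2
    refine ⟨hq.1, ?_⟩
    simp only [mem_ofPred_eq]
    refine lt_of_le_of_lt ?_ hq2
    have := Nat.one_div_le_one_div (α := ℝ) hab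
    gcongr
  have hfin := le_of_tendsto (tendsto_finsetSum W fun w _ => hlim w) hev2
  simp only [measureReal_def]
  rw [← ENNReal.toReal_sum (fun w _ => vol_lt hρ (inter_subset_left.trans O_sub))]
  exact ENNReal.toReal_le_of_le_ofReal (by positivity) hfin

theorem feas_iff {ρ : ℝ} {w u : E} (hw : w ∈ board ρ)
    (h0 : (0 < w 0 ∨ 0 ≤ u 0)) (h1 : w 0 < 1 ∨ u 0 ≤ 0)
    (h2 : (0 < w 1 ∨ 0 ≤ u 1)) (h3 : w 1 < ρ ∨ u 1 ≤ 0) : feas ρ w u := by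
  have L : ∀ a b : ℝ, 0 ≤ a → (0 < a ∨ 0 ≤ b) → ∀ᶠ ε in 𝓝[>] (0 : ℝ), 0 ≤ a + ε * b := by
    intro a b ha h
    rcases h with h | h
    · have : ContinuousAt (fun ε : ℝ => a + ε * b) 0 := by fun_prop
      have := this.eventually (lt_mem_nhds (a := 0) (by simpa using h))
      filter_upwards [nhdsWithin_le_nhds this] with ε h using h.le
    · filter_upwards [self_mem_nhdsWithin] with ε hε
      have hε : 0 < ε := hε
      positivity
  obtain ⟨⟨a1, a2⟩, a3, a4⟩ := hw
  have f0 := L (w 0) (u 0) a1 h0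
  have f1 := L (1 - w 0) (- u 0) (by linarith) (by
    rcases h1 with h | h
    · left; linarith
    · right; linarith)
  have f2 := L (w 1) (u 1) a3 h2
  have f3 := L (ρ - w 1) (- u 1) (by linarith) (by
    rcases h3 with h | h
    · left; linarith
    · right; linarith)
  unfold feas
  filter_upwards [f0, f1, f2, f3] with ε g0 g1 g2 g3
  refine ⟨⟨?_, ?_⟩, ?_, ?_⟩ <;> simp <;> linarith

theorem exists_dir {ρ : ℝ} (hρ : 0 < ρ) (W : Set E) (w : E) (hw : w ∈ board ρ) :
    ∃ u : E, feas ρ w u ∧ volume.real (O ρ W w) / 2 ≤ volume.real (O ρ W w ∩ H w u) := by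
  let e : E := EuclideanSpace.single 0 1
  have e0 : e 0 = 1 := by simp [e]
  have e1 : e 1 = 0 := by simp [e]
  have he : e ≠ 0 := by
    intro h; rw [h] at e0; simp at e0
  have hs := split hρ (O_sub (ρ := ρ) (W := W) (w := w)) w he
  have fp : w 0 < 1 → feas ρ w e := fun h => feas_iff hw (by simp [e0]) (Or.inl h) (by simp [e1]) (by simp [e1])
  have fm : 0 < w 0 → feas ρ w (-e) := fun h =>
    feas_iff hw (Or.inl h) (by simp [e0]) (by simp [e1]) (by simp [e1])
  have n1 : 0 ≤ volume.real (O ρ W w ∩ H w e) := measureReal_nonneg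
  have n2 : 0 ≤ volume.real (O ρ W w ∩ H w (-e)) := measureReal_nonneg
  obtain ⟨⟨a1, a2⟩, -⟩ := hw
  rcases a1.eq_or_lt with h | h
  · have : O ρ W w ∩ H w (-e) = ∅ := by
      rw [Set.eq_empty_iff_forall_notMem]
      rintro q ⟨hq, hh⟩
      simp only [H, mem_ofPred_eq, inner2] at hh
      simp [e0, e1] at hh
      have := hq.1.1.1
      linarith
    rw [this] at hs
    simp at hs
    exact ⟨e, fp (by linarith), by linarith⟩
  rcases a2.eq_or_lt with h' | h'
  · have : O ρ W w ∩ H w e = ∅ := by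
      rw [Set.eq_empty_iff_forall_notMem]
      rintro q ⟨hq, hh⟩
      simp only [H, mem_ofPred_eq, inner2] at hh
      simp [e0, e1] at hh
      have := hq.1.1.2
      linarith
    rw [this] at hs
    simp at hs
    exact ⟨-e, fm h, by linarith⟩
  by_cases hc : volume.real (O ρ W w) / 2 ≤ volume.real (O ρ W w ∩ H w e)
  · exact ⟨e, fp h', hc⟩
  · exact ⟨-e, fm h, by linarith⟩

theorem halfA {ρ : ℝ} (hρ : 0 < ρ) (W : Finset E) (hWQ : ∀ w ∈ W, w ∈ board ρ) (hnw : NoWin ρ W)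
    (w : E) (hw : w ∈ W) (u : E) (hf : feas ρ w u) :
    volume.real (O ρ W w ∩ H w u) ≤ volume.real (O ρ W w) / 2 := by
  classical
  by_contra hcon
  push Not at hcon
  have hd := fun w' : E => exists_dir hρ (W : Set E) w'
  choose! g hg1 hg2 using hd
  let g' := Function.update g w u
  have e : g' w = u := by simp [g']
  have e' : ∀ w', w' ≠ w → g' w' = g w' := fun w' h => by simp [g', h]
  have h1 := half hρ W hnw g' (by
    intro w' hw'
    by_cases h : w' = w
    · rw [h, e]; exact hf
    · rw [e' _ h]; exact hg1 w' (hWQ w' hw'))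
  have h2 := total hρ W ⟨w, hw⟩
  have h3 : ∑ w' ∈ W, volume.real (O ρ W w') / 2 <
      ∑ w' ∈ W, volume.real (O ρ W w' ∩ H w' (g' w')) := by
    apply Finset.sum_lt_sum
    · intro w' hw'
      by_cases h : w' = w
      · rw [h, e]; exact hcon.le
      · rw [e' _ h]; exact hg2 w' (hWQ w' hw')
    · exact ⟨w, hw, by rw [e]; exact hcon⟩
  rw [← Finset.sum_div] at h3
  linarith

def U (ρ : ℝ) (W : Set E) (w : E) : Set E :=
  {q | (0 < q 0 ∧ q 0 < 1 ∧ 0 < q 1 ∧ q 1 < ρ) ∧ ∀ w' ∈ W, w' ≠ w → dist q w < dist q w'}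

theorem U_sub {ρ : ℝ} {W : Set E} {w : E} : U ρ W w ⊆ O ρ W w := by
  rintro q ⟨⟨a, b, c, d⟩, h⟩
  exact ⟨⟨⟨a.le, b.le⟩, c.le, d.le⟩, h⟩

theorem U_open (ρ : ℝ) {W : Set E} (hW : W.Finite) (w : E) : IsOpen (U ρ W w) := by
  have : U ρ W w = ({q | 0 < q 0} ∩ {q | q 0 < 1} ∩ {q | 0 < q 1} ∩ {q | q 1 < ρ}) ∩
      ⋂ w' ∈ W, {q | w' ≠ w → dist q w < dist q w'} := by
    ext q; simp [U]; tauto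
  rw [this]
  refine IsOpen.inter ?_ (hW.isOpen_biInter fun w' _ => ?_)
  · exact (((isOpen_lt (by fun_prop) (by fun_prop)).inter (isOpen_lt (by fun_prop) (by fun_prop))).inter
      (isOpen_lt (by fun_prop) (by fun_prop))).inter (isOpen_lt (by fun_prop) (by fun_prop))
  by_cases h : w' = w
  · simp [h]
  · simp only [ne_eq, h, not_false_eq_true, forall_const]
    exact isOpen_lt (by fun_prop) (by fun_prop)

theorem O_pos {ρ : ℝ} (hρ : 0 < ρ) {W : Set E} (hW : W.Finite) (w : E) (hw : w ∈ board ρ) :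
    0 < volume.real (O ρ W w) := by
  have hne : (U ρ W w).Nonempty := by
    have h1 : ∀ᶠ t in 𝓝[>] (0 : ℝ), ∀ w' ∈ W, w' ≠ w →
        dist (w + t • (pt (1 / 2) (ρ / 2) - w)) w < dist (w + t • (pt (1 / 2) (ρ / 2) - w)) w' := by
      rw [Filter.eventually_all_finite hW]
      intro w' _
      by_cases h : w' = w
      · simp [h]
      · simp only [ne_eq, h, not_false_eq_true, forall_const]
        apply nhdsWithin_le_nhds
        apply ContinuousAt.eventually_lt (by fun_prop) (by fun_prop)
        simpa using dist_pos.2 (Ne.symm h)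
    have h2 : ∀ᶠ t in 𝓝[>] (0 : ℝ), t < 1 := nhdsWithin_le_nhds (Iio_mem_nhds (by norm_num))
    obtain ⟨t, ⟨ht1, ht2⟩, ht0⟩ := ((h1.and h2).and self_mem_nhdsWithin).exists
    have ht0 : 0 < t := ht0
    refine ⟨_, ?_, ht1⟩
    obtain ⟨⟨a1, a2⟩, a3, a4⟩ := hw
    simp [pt]
    refine ⟨?_, ?_, ?_, ?_⟩ <;> nlinarith
  have h1 := (U_open ρ hW w).measure_pos volume hne
  rw [measureReal_def]
  exact ENNReal.toReal_pos (h1.trans_le (measure_mono U_sub)).ne' (vol_lt hρ O_sub)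

theorem not_bdry {ρ : ℝ} (hρ : 0 < ρ) (W : Finset E) (hWQ : ∀ w ∈ W, w ∈ board ρ) (hnw : NoWin ρ W)
    (w : E) (hw : w ∈ W) (u : E) (hu : u ≠ 0) (hf : feas ρ w u)
    (hb : ∀ q ∈ board ρ, 0 ≤ inner ℝ (q - w) u) : False := by
  have h1 := halfA hρ W hWQ hnw w hw u hf
  have h2 := O_pos hρ W.finite_toSet w (hWQ w hw)
  have h3 := split hρ (O_sub (ρ := ρ) (W := W) (w := w)) w hu
  have : O ρ W w ∩ H w (-u) = ∅ := by
    rw [Set.eq_empty_iff_forall_notMem]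
    rintro q ⟨hq, hh⟩
    have := hb q hq.1
    simp only [H, mem_ofPred_eq, inner_neg_right] at hh
    linarith
  rw [this] at h3
  simp at h3
  linarith

theorem interior_pos {ρ : ℝ} (hρ : 0 < ρ) (W : Finset E) (hWQ : ∀ w ∈ W, w ∈ board ρ)
    (hnw : NoWin ρ W) (w : E) (hw : w ∈ W) : 0 < w 0 ∧ w 0 < 1 ∧ 0 < w 1 ∧ w 1 < ρ := by
  have hb := hWQ w hw
  obtain ⟨⟨a1, a2⟩, a3, a4⟩ := hWQ w hw
  refine ⟨lt_of_le_of_ne a1 fun h => ?_, lt_of_le_of_ne a2 fun h => ?_,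
    lt_of_le_of_ne a3 fun h => ?_, lt_of_le_of_ne a4 fun h => ?_⟩
  · refine not_bdry hρ W hWQ hnw w hw (pt 1 0) (fun h => ?_) (feas_iff hb ?_ ?_ ?_ ?_) fun q hq => ?_
    · simpa [pt] using congrArg (fun x : E => x 0) h
    · simp [pt]
    · left; linarith
    · simp [pt]
    · simp [pt]
    · rw [inner2]; simp [pt]; linarith [hq.1.1]
  · refine not_bdry hρ W hWQ hnw w hw (pt (-1) 0) (fun h => ?_) (feas_iff hb ?_ ?_ ?_ ?_) fun q hq => ?_
    · simpa [pt] using congrArg (fun x : E => x 0) h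
    · left; linarith
    · simp [pt]
    · simp [pt]
    · simp [pt]
    · rw [inner2]; simp [pt]; linarith [hq.1.2]
  · refine not_bdry hρ W hWQ hnw w hw (pt 0 1) (fun h => ?_) (feas_iff hb ?_ ?_ ?_ ?_) fun q hq => ?_
    · simpa [pt] using congrArg (fun x : E => x 1) h
    · simp [pt]
    · simp [pt]
    · simp [pt]
    · left; linarith
    · rw [inner2]; simp [pt]; linarith [hq.2.1]
  · refine not_bdry hρ W hWQ hnw w hw (pt 0 (-1)) (fun h => ?_) (feas_iff hb ?_ ?_ ?_ ?_) fun q hq => ?_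
    · simpa [pt] using congrArg (fun x : E => x 1) h
    · simp [pt]
    · simp [pt]
    · left; linarith
    · simp [pt]
    · rw [inner2]; simp [pt]; linarith [hq.2.2]

def V (ρ : ℝ) (W : Set E) (w : E) : Set E :=
  {q | q ∈ board ρ ∧ ∀ w' ∈ W, dist q w ≤ dist q w'}

theorem O_sub_V {ρ : ℝ} {W : Set E} {w : E} : O ρ W w ⊆ V ρ W w := by
  rintro q ⟨h1, h2⟩
  refine ⟨h1, fun w' hw' => ?_⟩
  by_cases h : w' = w
  · rw [h]
  · exact (h2 w' hw' h).le

theorem V_closed (ρ : ℝ) (W : Set E) (w : E) : IsClosed (V ρ W w) := by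
  have : V ρ W w = board ρ ∩ ⋂ w' ∈ W, {q | dist q w ≤ dist q w'} := by
    ext q; simp [V]
  rw [this]
  exact (closed_board ρ).inter (isClosed_biInter fun w' _ => isClosed_le (by fun_prop) (by fun_prop))

theorem V_star {ρ : ℝ} {W : Set E} {w : E} (hw : w ∈ board ρ) {y : E} (hy : w + y ∈ V ρ W w)
    {t : ℝ} (t0 : 0 ≤ t) (t1 : t ≤ 1) : w + t • y ∈ V ρ W w := by
  obtain ⟨⟨⟨a1, a2⟩, a3, a4⟩, h⟩ := hy
  obtain ⟨⟨b1, b2⟩, b3, b4⟩ := hw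
  simp only [PiLp.add_apply] at a1 a2 a3 a4
  refine ⟨⟨⟨?_, ?_⟩, ?_, ?_⟩, fun w' hw' => ?_⟩
  · simp; nlinarith
  · simp; nlinarith
  · simp; nlinarith
  · simp; nlinarith
  · have := (le_iff w w' y).1 (h w' hw')
    rw [le_iff, real_inner_smul_left]
    nlinarith [sq_nonneg ‖w' - w‖]

theorem V_star' {ρ : ℝ} {W : Set E} {w : E} (hw : 0 < w 0 ∧ w 0 < 1 ∧ 0 < w 1 ∧ w 1 < ρ)
    {y : E} (hy : w + y ∈ V ρ W w)
    {t : ℝ} (t0 : 0 ≤ t) (t1 : t < 1) : w + t • y ∈ U ρ W w := by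
  obtain ⟨⟨⟨a1, a2⟩, a3, a4⟩, h⟩ := hy
  obtain ⟨b1, b2, b3, b4⟩ := hw
  simp only [PiLp.add_apply] at a1 a2 a3 a4
  refine ⟨⟨?_, ?_, ?_, ?_⟩, fun w' hw' hne => ?_⟩
  · simp; nlinarith
  · simp; nlinarith
  · simp; nlinarith
  · simp; nlinarith
  · have := (le_iff w w' y).1 (h w' hw')
    rw [lt_iff, real_inner_smul_left]
    have : 0 < ‖w' - w‖ := norm_pos_iff.2 (sub_ne_zero.2 hne)
    have : 0 < ‖w' - w‖ ^ 2 := by positivity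
    nlinarith

theorem sym {ρ : ℝ} (hρ : 0 < ρ) (W : Finset E) (hWQ : ∀ w ∈ W, w ∈ board ρ) (hnw : NoWin ρ W)
    (w : E) (hw : w ∈ W) (z₀ : E) (hz₀ : w + z₀ ∈ V ρ W w) : w - z₀ ∈ V ρ W w := by
  by_contra hcon
  have hint := interior_pos hρ W hWQ hnw w hw
  have hwV : w ∈ V ρ W w := ⟨hWQ w hw, fun w' _ => by simp⟩
  let N : Set E := {y | w + y ∈ U ρ W w ∧ w - y ∉ V ρ W w}
  have hN : IsOpen N := by
    apply IsOpen.inter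
    · exact (U_open ρ W.finite_toSet w).preimage (by fun_prop : Continuous fun y : E => w + y)
    · exact (V_closed ρ W w).isOpen_compl.preimage (by fun_prop : Continuous fun y : E => w - y)
  -- choose an interior witness
  obtain ⟨z, hz⟩ : ∃ z, z ∈ N := by
    have c : ContinuousAt (fun t : ℝ => w - t • z₀) 1 := by fun_prop
    have h1 := c.eventually ((V_closed ρ W w).isOpen_compl.mem_nhds (by simpa using hcon))
    have h2 : ∀ᶠ t in 𝓝[<] (1 : ℝ), 0 < t := nhdsWithin_le_nhds (lt_mem_nhds (by norm_num))
    obtain ⟨t, ⟨ht1, ht2⟩, ht3⟩ := (((h1.filter_mono nhdsWithin_le_nhds).and h2).and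
      self_mem_nhdsWithin).exists
    exact ⟨t • z₀, V_star' hint hz₀ ht2.le ht3, ht1⟩
  have hz0 : z ≠ 0 := by
    rintro rfl
    exact hz.2 (by simpa using hwV)
  have hzz : 0 < inner ℝ z z := by
    rw [real_inner_self_eq_norm_sq]
    have := norm_pos_iff.2 hz0
    positivity
  let J : E := pt (-(z 1)) (z 0)
  have J0 : J 0 = -(z 1) := by simp [J, pt]
  have J1 : J 1 = z 0 := by simp [J, pt]
  have hzJ : inner ℝ z J = 0 := by rw [inner2, J0, J1]; ring
  obtain ⟨η, hη, hηN⟩ : ∃ η > 0, ∀ s : ℝ, |s| < η → z + s • J ∈ N := by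
    have c : ContinuousAt (fun s : ℝ => z + s • J) 0 := by fun_prop
    have h1 := c.eventually (hN.mem_nhds (by simpa using hz))
    obtain ⟨η, hη, h⟩ := Metric.eventually_nhds_iff.1 h1
    exact ⟨η, hη, fun s hs => h (by simpa [Real.dist_eq] using hs)⟩
  let u₁ : E := J + η • z
  let u₂ : E := J - η • z
  have i1 : ∀ y : E, inner ℝ y u₁ = inner ℝ y J + η * inner ℝ y z := by
    intro y; simp only [u₁, inner_add_right, real_inner_smul_right]
  have i2 : ∀ y : E, inner ℝ y u₂ = inner ℝ y J - η * inner ℝ y z := by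
    intro y; simp only [u₂, inner_sub_right, real_inner_smul_right]
  have hu1 : u₁ ≠ 0 := by
    intro h
    have := i1 z
    rw [h, inner_zero_right, hzJ] at this
    nlinarith
  have hu2 : u₂ ≠ 0 := by
    intro h
    have := i2 z
    rw [h, inner_zero_right, hzJ] at this
    nlinarith
  have hwedge : ∀ y : E, 0 < inner ℝ y u₁ → inner ℝ y u₂ < 0 → ∃ c : ℝ, c > 0 ∧ ∃ n ∈ N, y = c • n := by
    intro y h1 h2
    rw [i1] at h1
    rw [i2] at h2
    have h3 : 0 < inner ℝ y z := by
      by_contra h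
      push Not at h
      nlinarith
    refine ⟨inner ℝ y z / inner ℝ z z, by positivity, z + (inner ℝ y J / inner ℝ y z) • J,
      hηN _ ?_, ?_⟩
    · rw [abs_div, abs_of_pos h3, div_lt_iff₀ h3, abs_lt]
      constructor <;> linarith
    · rw [smul_add, smul_smul]
      have e : inner ℝ y z / inner ℝ z z * (inner ℝ y J / inner ℝ y z) = inner ℝ y J / inner ℝ z z := by
        field_simp
      rw [e]
      have hzz' : z 0 * z 0 + z 1 * z 1 ≠ 0 := by rw [← inner2]; exact hzz.ne'
      rw [inner2 y z, inner2 y J, inner2 z z, J0, J1]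
      obtain ⟨D, hD⟩ : ∃ D, D = z 0 * z 0 + z 1 * z 1 := ⟨_, rfl⟩
      rw [← hD] at hzz' ⊢
      ext i
      fin_cases i
      · simp [J0, J1]
        field_simp
        rw [hD]
        ring
      · simp [J0, J1]
        field_simp
        rw [hD]
        ring
  have hfe : ∀ u, feas ρ w u := fun u =>
    feas_iff (hWQ w hw) (Or.inl hint.1) (Or.inl hint.2.1) (Or.inl hint.2.2.1) (Or.inl hint.2.2.2)
  have heq : ∀ u, u ≠ 0 → volume.real (O ρ W w ∩ H w u) = volume.real (O ρ W w) / 2 := by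
    intro u hu
    have h1 := halfA hρ W hWQ hnw w hw u (hfe u)
    have h2 := halfA hρ W hWQ hnw w hw (-u) (hfe (-u))
    have h3 := split hρ (O_sub (ρ := ρ) (W := W) (w := w)) w hu
    linarith
  have s1 := split hρ (S := O ρ W w ∩ H w u₁) (inter_subset_left.trans O_sub) w hu2
  have s2 := split hρ (S := O ρ W w ∩ H w u₂) (inter_subset_left.trans O_sub) w hu1
  rw [heq _ hu1] at s1
  rw [heq _ hu2] at s2
  have s3 : O ρ W w ∩ H w u₂ ∩ H w u₁ = O ρ W w ∩ H w u₁ ∩ H w u₂ := by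
    ext q; simp only [mem_inter_iff]; tauto
  rw [s3] at s2
  let X := O ρ W w ∩ H w u₁ ∩ H w (-u₂)
  let Y := O ρ W w ∩ H w u₂ ∩ H w (-u₁)
  have hXY : volume.real X = volume.real Y := by simp only [X, Y]; linarith
  have hX : X ⊆ board ρ := inter_subset_left.trans (inter_subset_left.trans O_sub)
  have hY : Y ⊆ board ρ := inter_subset_left.trans (inter_subset_left.trans O_sub)
  have hXY' : volume X = volume Y := by
    rwa [measureReal_def, measureReal_def, ENNReal.toReal_eq_toReal_iff' (vol_lt hρ hX) (vol_lt hρ hY)] at hXY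
  let σ : E → E := fun q => (2 : ℝ) • w - q
  have hσ : MeasurePreserving σ volume volume := Measure.measurePreserving_sub_left volume _
  have hYm : MeasurableSet Y := ((meas_O ρ W.finite_toSet w).inter (open_H w u₂).measurableSet).inter
    (open_H w (-u₁)).measurableSet
  have hσY : volume (σ ⁻¹' Y) = volume Y := hσ.measure_preimage hYm.nullMeasurableSet
  let T : Set E := {q | q - w ∈ N} ∩ H w u₁ ∩ H w (-u₂)
  have hT : IsOpen T := ((hN.preimage (by fun_prop : Continuous fun q : E => q - w)).inter
    (open_H _ _)).inter (open_H _ _)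
  have hTne : T.Nonempty := by
    refine ⟨w + z, ⟨?_, ?_⟩, ?_⟩
    · simpa using hz
    · simp only [H, mem_ofPred_eq, add_sub_cancel_left, i1, hzJ]; nlinarith
    · simp only [H, mem_ofPred_eq, add_sub_cancel_left, inner_neg_right, i2, hzJ]; nlinarith
  have hTpos := hT.measure_pos volume hTne
  have hTX : T ⊆ X := by
    rintro q ⟨⟨h1, h2⟩, h3⟩
    refine ⟨⟨U_sub ?_, h2⟩, h3⟩
    have := h1.1
    rwa [add_sub_cancel] at this
  have hYX : σ ⁻¹' Y ⊆ X := by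
    rintro q ⟨⟨h1, h2⟩, h3⟩
    have e : σ q - w = -(q - w) := by simp only [σ, two_smul]; abel
    have e' : σ q = w - (q - w) := by simp only [σ, two_smul]; abel
    simp only [H, mem_ofPred_eq, e, inner_neg_left, inner_neg_right] at h2 h3
    have g1 : 0 < inner ℝ (q - w) u₁ := by linarith
    have g2 : inner ℝ (q - w) u₂ < 0 := by linarith
    obtain ⟨c, hc, n, hn, hcn⟩ := hwedge _ g1 g2
    refine ⟨⟨?_, g1⟩, ?_⟩
    · have hv := O_sub_V h1
      rw [e', hcn] at hv
      have hc1 : c < 1 := by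
        by_contra hge
        push Not at hge
        apply hn.2
        have := V_star (hWQ w hw) (y := -(c • n)) (by rwa [← sub_eq_add_neg]) (t := c⁻¹)
          (by positivity) (inv_le_one_of_one_le₀ hge)
        rwa [smul_neg, smul_smul, inv_mul_cancel₀ hc.ne', one_smul, ← sub_eq_add_neg] at this
      have := V_star' hint (O_sub_V (U_sub hn.1)) hc.le hc1
      rw [← hcn, add_sub_cancel] at this
      exact U_sub this
    · simp only [H, mem_ofPred_eq, inner_neg_right]; linarith
  have hdis : Disjoint (σ ⁻¹' Y) T := by
    rw [Set.disjoint_left]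
    rintro q ⟨⟨h1, -⟩, -⟩ ⟨⟨h2, -⟩, -⟩
    apply h2.2
    have e' : σ q = w - (q - w) := by simp only [σ, two_smul]; abel
    rw [← e']
    exact O_sub_V h1
  have hfin := measure_mono (μ := volume) (union_subset hYX hTX)
  rw [measure_union hdis hT.measurableSet, hσY, hXY'] at hfin
  have hlt : volume Y < volume Y + volume T :=
    ENNReal.lt_add_right (vol_lt hρ hY) hTpos.ne'
  exact absurd hfin (not_le.2 hlt)

end VM

theorem VM.dsq_eq (p q : VM.E) : VG.dsq (p 0, p 1) (q 0, q 1) = dist p q ^ 2 := by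
  rw [EuclideanSpace.dist_eq, Real.sq_sqrt (by positivity), Fin.sum_univ_two]
  simp [VG.dsq, Real.dist_eq, sq_abs]

theorem VM.good {ρ : ℝ} (hρ : 0 < ρ) (W : Finset VM.E) (hne : W.Nonempty)
    (hWQ : ∀ w ∈ W, w ∈ board ρ) (hnw : VM.NoWin ρ W) :
    VG.Good 1 ρ ((fun q : VM.E => (q 0, q 1)) '' W) where
  hA := one_pos
  hC := hρ
  fin := W.finite_toSet.image _
  ne := by
    obtain ⟨w, hw⟩ := hne
    exact ⟨_, w, hw, rfl⟩
  pos := by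
    rintro _ ⟨w, hw, rfl⟩
    exact VM.interior_pos hρ W hWQ hnw w hw
  sym := by
    rintro _ ⟨w, hw, rfl⟩ x y hc
    have hcV : ∀ q : VM.E, VG.cel 1 ρ ((fun q : VM.E => (q 0, q 1)) '' W) (w 0, w 1) (q 0, q 1) ↔
        q ∈ VM.V ρ W w := by
      intro q
      constructor
      · rintro ⟨h1, h2, h3, h4, h5⟩
        refine ⟨⟨⟨h1, h2⟩, h3, h4⟩, fun w' hw' => ?_⟩
        have := h5 _ ⟨w', hw', rfl⟩
        simp only [VM.dsq_eq] at this
        exact (sq_le_sq₀ dist_nonneg dist_nonneg).1 this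
      · rintro ⟨⟨⟨h1, h2⟩, h3, h4⟩, h5⟩
        refine ⟨h1, h2, h3, h4, ?_⟩
        rintro _ ⟨w', hw', rfl⟩
        simp only [VM.dsq_eq]
        exact (sq_le_sq₀ dist_nonneg dist_nonneg).2 (h5 w' hw')
    have h1 : pt x y ∈ VM.V ρ W w := by
      rw [← hcV]
      simpa [pt] using hc
    have h2 := VM.sym hρ W hWQ hnw w hw (pt x y - w) (by simpa using h1)
    have h3 := (hcV _).2 h2
    have e0 : (w - (pt x y - w)) 0 = 2 * w 0 - x := by simp [pt]; ring
    have e1 : (w - (pt x y - w)) 1 = 2 * w 1 - y := by simp [pt]; ring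
    rw [e0, e1] at h3
    exact h3

/-- If Barney cannot claim more than half the board against Wilma's `n`-point
placement `W`, then the Voronoi diagram of `W` is a regular grid: `W` is the set
of cell centers of a uniform `k × m` rectangular subdivision of the board. -/
theorem stmt_7 (ρ : ℝ) (hρ0 : 0 < ρ) (hρ1 : ρ ≤ 1) (n : ℕ) (hn : 1 ≤ n)
    (W : Set (EuclideanSpace ℝ (Fin 2))) (hWQ : W ⊆ board ρ) (hWfin : W.Finite)
    (hWcard : W.ncard = n)
    (hnowin : ∀ B : Set (EuclideanSpace ℝ (Fin 2)), B ⊆ board ρ → B.Finite → B.ncard = n →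
      volume {q | q ∈ board ρ ∧ infDist q B < infDist q W} ≤ ENNReal.ofReal (ρ / 2)) :
    ∃ k m : ℕ, k * m = n ∧
      W = Set.range fun p : Fin k × Fin m =>
        pt ((2 * (p.1 : ℝ) + 1) / (2 * k)) ((2 * (p.2 : ℝ) + 1) * ρ / (2 * m)) := by
  obtain ⟨W, rfl⟩ := hWfin.exists_finset_coe
  rw [Set.ncard_coe_finset] at hWcard
  subst hWcard
  have hne : W.Nonempty := Finset.card_pos.1 (by omega)
  obtain ⟨k, m, a, b, ha, hb, hk, hm, hgrid⟩ := VG.grid (VM.good hρ0 W hne (fun w hw => hWQ hw) hnowin)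
  have hk0 : (k : ℝ) ≠ 0 := by rintro h; rw [h] at hk; simp at hk
  have hm0 : (m : ℝ) ≠ 0 := by rintro h; rw [h] at hm; simp at hm; linarith
  have ea : ∀ i : ℝ, (2 * i + 1) / (2 * k) = (2 * i + 1) * a := by
    intro i
    rw [div_eq_iff (by positivity)]
    linear_combination (2 * i + 1) * hk
  have eb : ∀ i : ℝ, (2 * i + 1) * ρ / (2 * m) = (2 * i + 1) * b := by
    intro i
    rw [div_eq_iff (by positivity)]
    linear_combination (2 * i + 1) * hm
  have hW : (W : Set (EuclideanSpace ℝ (Fin 2))) = Set.range fun p : Fin k × Fin m =>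
        pt ((2 * (p.1 : ℝ) + 1) / (2 * k)) ((2 * (p.2 : ℝ) + 1) * ρ / (2 * m)) := by
    ext q
    have hq : q ∈ (W : Set (EuclideanSpace ℝ (Fin 2))) ↔
        (q 0, q 1) ∈ (fun q : VM.E => (q 0, q 1)) '' (W : Set VM.E) := by
      constructor
      · intro h; exact ⟨q, h, rfl⟩
      · rintro ⟨q', h, he⟩
        simp only [Prod.mk.injEq] at he
        have : q' = q := by
          ext i; fin_cases i
          · exact he.1
          · exact he.2
        rwa [← this]
    rw [hq, hgrid]
    simp only [ea, eb, Set.mem_range, Prod.exists, Prod.mk.injEq]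
    constructor
    · rintro ⟨i, hi, j, hj, h1, h2⟩
      refine ⟨⟨i, hi⟩, ⟨j, hj⟩, ?_⟩
      ext l; fin_cases l
      · simpa [pt] using h1.symm
      · simpa [pt] using h2.symm
    · rintro ⟨i, j, rfl⟩
      exact ⟨i, i.2, j, j.2, by simp [pt], by simp [pt]⟩
  refine ⟨k, m, ?_, hW⟩
  have hcard : (W : Set (EuclideanSpace ℝ (Fin 2))).ncard = k * m := by
    rw [hW, ← Set.image_univ, Set.InjOn.ncard_image, Set.ncard_univ]
    · simp
    · rintro ⟨i, j⟩ - ⟨i', j'⟩ - h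
      simp only [ea, eb] at h
      have h1 : (2 * (i : ℝ) + 1) * a = (2 * (i' : ℝ) + 1) * a := by
        simpa [pt] using congrArg (fun x : VM.E => x 0) h
      have h2 : (2 * (j : ℝ) + 1) * b = (2 * (j' : ℝ) + 1) * b := by
        simpa [pt] using congrArg (fun x : VM.E => x 1) h
      have h1 := mul_right_cancel₀ ha.ne' h1
      have h2 := mul_right_cancel₀ hb.ne' h2
      have h1 : (i : ℝ) = i' := by linarith
      have h2 : (j : ℝ) = j' := by linarith
      have h1 : (i : ℕ) = i' := by exact_mod_cast h1
      have h2 : (j : ℕ) = j' := by exact_mod_cast h2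
      rw [Prod.mk.injEq]
      exact ⟨Fin.ext h1, Fin.ext h2⟩
  rw [Set.ncard_coe_finset] at hcard
  exact hcard.symm
end
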